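/- arXiv:math/9806022 — 8 statements merged into one kernel-verified Lean document; each statement's English description precedes it below -/
import Mathlib

section
/- Let (f_n)_{n≥1} be a sequence of real-valued random variables on a probability space (Ω,ℱ,ℙ) such that for every n ≥ 0, f_{n+1} is nowhere constant with respect to σ(f_1,…,f_n). Then there exists a sequence of Borel measurable functions g_n : [0,1]^n → ℝ having the same law as (f_n), satisfying σ(g_1,…,g_n) = ℒ_n for all n ≥ 1, and such that for almost every (x_1,…,x_{n−1}) ∈ [0,1]^{n−1}, the map x_n ↦ g_n(x_1,…,x_n) is strictly increasing on (0,1). -/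
open MeasureTheory MeasurableSpace
open scoped unitInterval

noncomputable section

/-- The product Lebesgue measure on `[0,1]^n`. -/
def lamFin (n : ℕ) : Measure (Fin n → I) := Measure.pi fun _ => volume

/-- The canonical lifting of a sequence of functions `g k : [0,1]^(k+1) → S`
(0-based indexing) to a map `[0,1]^n → S^n` recording the first `n` terms. -/
def seqLift {S : Type*} (g : (k : ℕ) → (Fin (k + 1) → I) → S) (n : ℕ) :
    (Fin n → I) → Fin n → S :=
  fun x k => g k (fun j => x ⟨j.1, lt_of_lt_of_le j.2 k.2⟩)

/-- `σ(f_1,…,f_n)`: the minimal sigma field containing all `ℙ`-null sets for which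
`f_1,…,f_n` (0-based: `f 0, …, f (n-1)`) are measurable. -/
def sigmaUpTo {Ω S : Type*} [MeasurableSpace Ω] [MeasurableSpace S] (ℙ : Measure Ω)
    (f : ℕ → Ω → S) (n : ℕ) : MeasurableSpace Ω :=
  MeasurableSpace.comap (fun ω (k : Fin n) => f k ω) MeasurableSpace.pi
    ⊔ MeasurableSpace.generateFrom {s : Set Ω | ℙ s = 0}

section

open ProbabilityTheory

/-- The quantile function of a measure on `ℝ`, extended by `0` outside `(0,1)`. -/
def quantile (μ : Measure ℝ) (u : ℝ) : ℝ :=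
  open Classical in if u ∈ Set.Ioo (0 : ℝ) 1 then sInf {t | u ≤ cdf μ t} else 0

theorem quantile_le_iff (μ : Measure ℝ) {u : ℝ} (hu : u ∈ Set.Ioo (0 : ℝ) 1) (t : ℝ) :
    quantile μ u ≤ t ↔ u ≤ cdf μ t := by
  have hne : {t | u ≤ cdf μ t}.Nonempty := by
    obtain ⟨t, ht⟩ := ((tendsto_cdf_atTop μ).eventually (lt_mem_nhds hu.2)).exists
    exact ⟨t, ht.le⟩
  have hbdd : BddBelow {t | u ≤ cdf μ t} := by
    obtain ⟨t, ht⟩ := ((tendsto_cdf_atBot μ).eventually (gt_mem_nhds hu.1)).exists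
    refine ⟨t, fun s hs => ?_⟩
    by_contra! hlt
    exact absurd (hs.trans (monotone_cdf μ hlt.le)) (not_le.2 ht)
  rw [quantile, if_pos hu]
  refine ⟨fun h => le_trans ?_ (monotone_cdf μ h), fun h => csInf_le hbdd h⟩
  have hright : Filter.Tendsto (cdf μ) (nhdsWithin (sInf {t | u ≤ cdf μ t}) (Set.Ioi _))
      (nhds (cdf μ (sInf {t | u ≤ cdf μ t}))) :=
    ((cdf μ).right_continuous _).tendsto.mono_left
      (nhdsWithin_mono _ Set.Ioi_subset_Ici_self)
  refine ge_of_tendsto hright ?_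
  filter_upwards [self_mem_nhdsWithin] with s hs
  obtain ⟨r, hr, hrs⟩ := exists_lt_of_csInf_lt hne hs
  exact le_trans hr (monotone_cdf μ hrs.le)

theorem cdf_quantile (μ : Measure ℝ) [IsProbabilityMeasure μ] (hμ : ∀ t, μ {t} = 0)
    {u : ℝ} (hu : u ∈ Set.Ioo (0 : ℝ) 1) : cdf μ (quantile μ u) = u := by
  refine le_antisymm ?_ ((quantile_le_iff μ hu _).1 le_rfl)
  have hjump : cdf μ (quantile μ u) ≤ Function.leftLim (cdf μ) (quantile μ u) := by
    have h := hμ (quantile μ u)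
    rw [← measure_cdf μ, StieltjesFunction.measure_singleton, ENNReal.ofReal_eq_zero,
      measure_cdf μ] at h
    linarith
  refine hjump.trans (le_of_tendsto ((monotone_cdf μ).tendsto_leftLim _) ?_)
  filter_upwards [self_mem_nhdsWithin] with s hs
  by_contra! hlt
  exact absurd ((quantile_le_iff μ hu s).2 hlt.le) (not_le.2 hs)

theorem quantile_lt_quantile (μ : Measure ℝ) [IsProbabilityMeasure μ] (hμ : ∀ t, μ {t} = 0)
    {a b : ℝ} (ha : a ∈ Set.Ioo (0 : ℝ) 1) (hb : b ∈ Set.Ioo (0 : ℝ) 1) (hab : a < b) :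
    quantile μ a < quantile μ b := by
  by_contra! h
  rw [quantile_le_iff μ hb, cdf_quantile μ hμ ha] at h
  exact absurd hab (not_lt.2 h)

theorem exists_rat_quantile_eq (μ : Measure ℝ) [IsProbabilityMeasure μ] {t : ℝ}
    (ht : μ {t} ≠ 0) : ∃ u : ℚ, quantile μ u = t := by
  have hjump : Function.leftLim (cdf μ) t < cdf μ t := by
    by_contra! h
    apply ht
    rw [← measure_cdf μ, StieltjesFunction.measure_singleton, ENNReal.ofReal_eq_zero]
    linarith
  obtain ⟨u, hu1, hu2⟩ := exists_rat_btwn hjump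
  have hu : (u : ℝ) ∈ Set.Ioo (0 : ℝ) 1 :=
    ⟨((cdf_nonneg μ (t - 1)).trans ((monotone_cdf μ).le_leftLim (by linarith))).trans_lt hu1,
      hu2.trans_le (cdf_le_one μ t)⟩
  refine ⟨u, le_antisymm ((quantile_le_iff μ hu t).2 hu2.le) ?_⟩
  by_contra! h
  exact absurd ((quantile_le_iff μ hu _).1 le_rfl)
    (not_le.2 (((monotone_cdf μ).le_leftLim h).trans_lt hu1))

theorem ae_coe_mem_Ioo : ∀ᵐ u : I, (u : ℝ) ∈ Set.Ioo (0 : ℝ) 1 := by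
  have h0 : ∀ᵐ u : I, u ≠ 0 := by simp [ae_iff]
  have h1 : ∀ᵐ u : I, u ≠ 1 := by simp [ae_iff]
  filter_upwards [h0, h1] with u hu0 hu1
  exact ⟨unitInterval.pos_iff_ne_zero.2 hu0, unitInterval.lt_one_iff_ne_one.2 hu1⟩

section Kernel

variable {α : Type*} [MeasurableSpace α] (κ : Kernel α ℝ) [IsMarkovKernel κ]

theorem measurable_cdf_kernel : Measurable fun p : α × ℝ => cdf (κ p.1) p.2 := by
  have hs : MeasurableSet {p : (α × ℝ) × ℝ | p.2 ≤ p.1.2} :=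
    measurableSet_le (by fun_prop) (by fun_prop)
  have h := (Kernel.measurable_kernel_prodMk_left (κ := Kernel.prodMkRight ℝ κ) hs).ennreal_toReal
  have heq : (fun p : α × ℝ => cdf (κ p.1) p.2) = fun p : α × ℝ =>
      (Kernel.prodMkRight ℝ κ p (Prod.mk p ⁻¹' {p : (α × ℝ) × ℝ | p.2 ≤ p.1.2})).toReal := by
    funext p
    rw [cdf_eq_real]
    rfl
  rwa [heq]

theorem measurable_quantile_kernel : Measurable fun p : α × ℝ => quantile (κ p.1) p.2 := by
  refine measurable_of_Iic fun t => ?_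
  have hI : MeasurableSet {p : α × ℝ | p.2 ∈ Set.Ioo (0 : ℝ) 1} :=
    measurable_snd measurableSet_Ioo
  have hc : Measurable fun p : α × ℝ => cdf (κ p.1) t :=
    (measurable_cdf_kernel κ).comp (by fun_prop : Measurable fun p : α × ℝ => (p.1, t))
  have hle : MeasurableSet {p : α × ℝ | p.2 ≤ cdf (κ p.1) t} :=
    measurableSet_le measurable_snd hc
  have heq : (fun p : α × ℝ => quantile (κ p.1) p.2) ⁻¹' Set.Iic t =
      ({p | p.2 ∈ Set.Ioo (0 : ℝ) 1} ∩ {p | p.2 ≤ cdf (κ p.1) t}) ∪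
        ({p | p.2 ∈ Set.Ioo (0 : ℝ) 1}ᶜ ∩ {_p | (0 : ℝ) ≤ t}) := by
    ext p
    by_cases hp : p.2 ∈ Set.Ioo (0 : ℝ) 1
    · simp only [Set.mem_preimage, Set.mem_Iic, quantile_le_iff _ hp, Set.mem_union,
        Set.mem_inter_iff, Set.mem_ofPred_eq, hp, Set.mem_compl_iff, true_and, not_true_eq_false,
        false_and, or_false]
    · simp only [Set.mem_preimage, Set.mem_Iic, quantile, Set.mem_union,
        Set.mem_inter_iff, Set.mem_ofPred_eq, hp, Set.mem_compl_iff, true_and, not_false_eq_true,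
        false_and, false_or, if_false]
  rw [heq]
  exact (hI.inter hle).union (hI.compl.inter (.const _))

theorem measurable_quantile (μ : Measure ℝ) [IsProbabilityMeasure μ] :
    Measurable (quantile μ) :=
  (measurable_quantile_kernel (Kernel.const Unit μ)).comp
    (by fun_prop : Measurable fun u : ℝ => ((), u))

theorem map_quantile (μ : Measure ℝ) [IsProbabilityMeasure μ] :
    Measure.map (fun u : I => quantile μ u) volume = μ := by
  have hm : Measurable fun u : I => quantile μ u :=
    (measurable_quantile μ).comp measurable_subtype_coe
  have := Measure.isProbabilityMeasure_map (μ := (volume : Measure I)) hm.aemeasurable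
  refine Measure.ext_of_Iic _ _ fun t => ?_
  rw [Measure.map_apply hm measurableSet_Iic, ← ofReal_cdf]
  have hx : cdf μ t ∈ I := ⟨cdf_nonneg μ t, cdf_le_one μ t⟩
  rw [← unitInterval.volume_Iic (⟨cdf μ t, hx⟩ : I)]
  refine measure_congr ?_
  filter_upwards [ae_coe_mem_Ioo] with u hu
  exact propext (quantile_le_iff μ hu t)

theorem map_prod_quantile (ν : Measure α) [SFinite ν] :
    Measure.map (fun p : α × I => (p.1, quantile (κ p.1) p.2)) (ν.prod volume) = ν ⊗ₘ κ := by
  have hm : Measurable fun p : α × I => (p.1, quantile (κ p.1) p.2) :=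
    measurable_fst.prodMk ((measurable_quantile_kernel κ).comp
      (by fun_prop : Measurable fun p : α × I => (p.1, (p.2 : ℝ))))
  ext s hs
  rw [Measure.map_apply hm hs, Measure.prod_apply (hm hs), Measure.compProd_apply hs]
  refine lintegral_congr fun a => ?_
  have hqa : Measurable fun u : I => quantile (κ a) u :=
    (measurable_quantile _).comp measurable_subtype_coe
  have h := Measure.map_apply (μ := volume) hqa (measurable_prodMk_left (x := a) hs)
  rw [map_quantile] at h
  rw [h]
  rfl

end Kernel

/-- If `Y` almost surely avoids every measurable function of `X`, then the conditional
distribution of `Y` given `X` almost surely has no atoms. -/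
theorem ae_condDistrib_singleton_eq_zero {Ω β : Type*} [MeasurableSpace Ω] [MeasurableSpace β]
    (P : Measure Ω) [IsProbabilityMeasure P] {X : Ω → β} {Y : Ω → ℝ} (hX : Measurable X)
    (hY : Measurable Y)
    (h : ∀ q : β → ℝ, Measurable q → P {ω | Y ω = q (X ω)} = 0) :
    ∀ᵐ y ∂(Measure.map X P), ∀ t, condDistrib Y X P y {t} = 0 := by
  have key : ∀ u : ℚ, ∀ᵐ y ∂(Measure.map X P),
      condDistrib Y X P y {quantile (condDistrib Y X P y) u} = 0 := by
    intro u
    have hq : Measurable fun y => quantile (condDistrib Y X P y) u :=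
      (measurable_quantile_kernel (condDistrib Y X P)).comp
        (by fun_prop : Measurable fun y : β => (y, (u : ℝ)))
    have hs : MeasurableSet {p : β × ℝ | p.2 = quantile (condDistrib Y X P p.1) u} :=
      measurableSet_eq_fun measurable_snd (hq.comp measurable_fst)
    have h0 : (Measure.map X P ⊗ₘ condDistrib Y X P)
        {p : β × ℝ | p.2 = quantile (condDistrib Y X P p.1) u} = 0 := by
      rw [compProd_map_condDistrib hY.aemeasurable, Measure.map_apply (hX.prodMk hY) hs]
      exact h _ hq
    rw [Measure.compProd_apply hs, lintegral_eq_zero_iff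
      (Kernel.measurable_kernel_prodMk_left hs)] at h0
    exact h0
  filter_upwards [ae_all_iff.2 key] with y hy t
  by_contra ht
  obtain ⟨u, rfl⟩ := exists_rat_quantile_eq _ ht
  exact ht (hy u)

theorem measurable_fin_snoc {γ : Type*} [MeasurableSpace γ] (n : ℕ) :
    Measurable fun p : (Fin n → γ) × γ => (Fin.snoc p.1 p.2 : Fin (n + 1) → γ) := by
  refine measurable_pi_lambda _ fun i => ?_
  refine Fin.lastCases ?_ (fun j => ?_) i
  · simpa using measurable_snd
  · simpa using (by fun_prop : Measurable fun p : (Fin n → γ) × γ => p.1 j)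

instance (n : ℕ) : IsProbabilityMeasure (lamFin n) := by unfold lamFin; infer_instance

theorem measurePreserving_init_last (n : ℕ) :
    MeasurePreserving (fun x : Fin (n + 1) → I => (Fin.init x, x (Fin.last n)))
      (lamFin (n + 1)) ((lamFin n).prod volume) := by
  have h := Measure.measurePreserving_swap.comp
    (measurePreserving_piFinSuccAbove (fun _ : Fin (n + 1) => (volume : Measure I)) (Fin.last n))
  refine (congrArg (fun F => MeasurePreserving F (lamFin (n + 1)) ((lamFin n).prod volume)) ?_).mp h
  funext x
  refine Prod.ext ?_ rfl
  funext j
  simp [Fin.init, MeasurableEquiv.piFinSuccAbove]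

/-- The iterated conditional quantile transform of a sequence of kernels. -/
def quantileTransform (κ : (n : ℕ) → Kernel (Fin n → ℝ) ℝ) :
    (n : ℕ) → (Fin n → I) → Fin n → ℝ
  | 0, _ => Fin.elim0
  | n + 1, x => Fin.snoc (quantileTransform κ n (Fin.init x))
      (quantile (κ n (quantileTransform κ n (Fin.init x))) (x (Fin.last n)))

theorem seqLift_quantileTransform (κ : (n : ℕ) → Kernel (Fin n → ℝ) ℝ) (n : ℕ) :
    seqLift (fun k x => quantileTransform κ (k + 1) x (Fin.last k)) n = quantileTransform κ n := by
  induction n with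
  | zero => funext x k; exact k.elim0
  | succ n ih =>
    funext x k
    refine Fin.lastCases ?_ (fun j => ?_) k
    · rfl
    · have h := congrFun (congrFun ih (Fin.init x)) j
      simp only [seqLift, quantileTransform, Fin.snoc_castSucc, Fin.snoc_last] at h ⊢
      exact h

section Transform

variable (κ : (n : ℕ) → Kernel (Fin n → ℝ) ℝ) [∀ n, IsMarkovKernel (κ n)]

theorem measurable_quantileTransform (n : ℕ) : Measurable (quantileTransform κ n) := by
  induction n with
  | zero => exact measurable_pi_lambda _ fun k => k.elim0
  | succ n ih =>
    have hinit := (measurePreserving_init_last n).measurable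
    have h1 : Measurable fun x : Fin (n + 1) → I => quantileTransform κ n (Fin.init x) :=
      ih.comp hinit.fst
    exact (measurable_fin_snoc n).comp (h1.prodMk ((measurable_quantile_kernel (κ n)).comp
      (h1.prodMk (measurable_subtype_coe.comp hinit.snd))))

theorem map_quantileTransform_succ (n : ℕ) :
    Measure.map (quantileTransform κ (n + 1)) (lamFin (n + 1)) =
      Measure.map (fun p : (Fin n → ℝ) × ℝ => (Fin.snoc p.1 p.2 : Fin (n + 1) → ℝ))
        (Measure.map (quantileTransform κ n) (lamFin n) ⊗ₘ κ n) := by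
  have hT := measurable_quantileTransform κ n
  have hq : Measurable fun p : (Fin n → ℝ) × I => (p.1, quantile (κ n p.1) p.2) :=
    measurable_fst.prodMk ((measurable_quantile_kernel (κ n)).comp
      (by fun_prop : Measurable fun p : (Fin n → ℝ) × I => (p.1, (p.2 : ℝ))))
  have hTid : MeasurePreserving (Prod.map (quantileTransform κ n) (id : I → I))
      ((lamFin n).prod volume) ((Measure.map (quantileTransform κ n) (lamFin n)).prod volume) :=
    (hT.measurePreserving _).prod (MeasurePreserving.id _)
  rw [← map_prod_quantile, ← hTid.map_eq, ← (measurePreserving_init_last n).map_eq,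
    Measure.map_map hq hTid.measurable,
    Measure.map_map (hq.comp hTid.measurable) (measurePreserving_init_last n).measurable,
    Measure.map_map (measurable_fin_snoc n)
      ((hq.comp hTid.measurable).comp (measurePreserving_init_last n).measurable)]
  rfl

theorem map_quantileTransform {Ω : Type*} [MeasurableSpace Ω] (P : Measure Ω)
    [IsProbabilityMeasure P] {f : ℕ → Ω → ℝ} (hf : ∀ n, Measurable (f n)) (n : ℕ) :
    Measure.map (quantileTransform
        (fun n => condDistrib (f n) (fun ω (k : Fin n) => f k ω) P) n) (lamFin n) =
      Measure.map (fun ω (k : Fin n) => f k ω) P := by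
  have hF (n : ℕ) : Measurable fun ω (k : Fin n) => f k ω :=
    measurable_pi_lambda _ fun k => hf k
  induction n with
  | zero =>
    have h1 := Measure.isProbabilityMeasure_map (μ := lamFin 0) (measurable_quantileTransform
      (fun n => condDistrib (f n) (fun ω (k : Fin n) => f k ω) P) 0).aemeasurable
    have h2 := Measure.isProbabilityMeasure_map (μ := P) (hF 0).aemeasurable
    ext s -
    rcases s.eq_empty_or_nonempty with rfl | hs
    · simp
    · rw [Subsingleton.eq_univ_of_nonempty hs, h1.measure_univ, h2.measure_univ]
  | succ n ih =>
    rw [map_quantileTransform_succ, ih, compProd_map_condDistrib (hf n).aemeasurable,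
      Measure.map_map (measurable_fin_snoc n) ((hF n).prodMk (hf n))]
    congr 1
    funext ω k
    refine Fin.lastCases ?_ (fun j => ?_) k <;> simp

/-- When the conditional laws have no atoms, the quantile transform has an almost sure left
inverse. -/
theorem exists_leftInverse_quantileTransform
    (hκ : ∀ n, ∀ᵐ y ∂(lamFin n), ∀ t, κ n (quantileTransform κ n y) {t} = 0) (n : ℕ) :
    ∃ Φ : (Fin n → ℝ) → Fin n → I, Measurable Φ ∧
      ∀ᵐ x ∂(lamFin n), Φ (quantileTransform κ n x) = x := by
  induction n with
  | zero =>
    exact ⟨fun _ k => k.elim0, measurable_pi_lambda _ fun k => k.elim0,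
      ae_of_all _ fun x => Subsingleton.elim _ _⟩
  | succ n ih =>
    obtain ⟨Φ, hΦ, hinv⟩ := ih
    have hinit : Measurable fun y : Fin (n + 1) → ℝ => Fin.init y :=
      measurable_pi_lambda _ fun j => measurable_pi_apply _
    refine ⟨fun y => Fin.snoc (Φ (Fin.init y))
      (⟨cdf (κ n (Fin.init y)) (y (Fin.last n)), cdf_nonneg _ _, cdf_le_one _ _⟩ : I), ?_, ?_⟩
    · exact (measurable_fin_snoc n).comp ((hΦ.comp hinit).prodMk
        (((measurable_cdf_kernel (κ n)).comp
          (hinit.prodMk (measurable_pi_apply (Fin.last n)))).subtype_mk))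
    · have hmp := measurePreserving_init_last n
      have h1 := hmp.quasiMeasurePreserving.ae
        (Measure.quasiMeasurePreserving_fst.ae (hinv.and (hκ n)))
      have h2 := hmp.quasiMeasurePreserving.ae
        (Measure.quasiMeasurePreserving_snd.ae ae_coe_mem_Ioo)
      filter_upwards [h1, h2] with x hx1 hx2
      have hc := cdf_quantile _ hx1.2 hx2
      funext k
      refine Fin.lastCases ?_ (fun j => ?_) k
      · simpa [quantileTransform, Subtype.ext_iff] using hc
      · simpa [Fin.init, quantileTransform] using congrFun hx1.1 j

end Transform

/-- A map with an almost sure measurable left inverse generates, together with the null sets,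
the null-measurable sets. -/
theorem measurableSet_comap_sup_null_iff {α β : Type*} [MeasurableSpace α] [MeasurableSpace β]
    {μ : Measure α} {T : α → β} (hT : Measurable T) {Φ : β → α} (hΦ : Measurable Φ)
    (hinv : ∀ᵐ x ∂μ, Φ (T x) = x) (s : Set α) :
    MeasurableSet[MeasurableSpace.comap T ‹_› ⊔ generateFrom {t : Set α | μ t = 0}] s ↔
      NullMeasurableSet s μ := by
  constructor
  · have hle : MeasurableSpace.comap T ‹_› ⊔ generateFrom {t : Set α | μ t = 0} ≤
        (inferInstance : MeasurableSpace (NullMeasurableSpace α μ)) := by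
      refine sup_le ?_ (generateFrom_le fun t ht => NullMeasurableSet.of_null ht)
      rintro _ ⟨t, ht, rfl⟩
      exact (hT ht).nullMeasurableSet
    exact hle s
  · intro hs
    have hnull (t : Set α) (ht : μ t = 0) :
        MeasurableSet[MeasurableSpace.comap T ‹_› ⊔ generateFrom {t : Set α | μ t = 0}] t :=
      le_sup_right (a := MeasurableSpace.comap T ‹_›) t (measurableSet_generateFrom ht)
    obtain ⟨t, ht, hst⟩ := hs
    have hpre : MeasurableSet[MeasurableSpace.comap T ‹_› ⊔
        generateFrom {t : Set α | μ t = 0}] (T ⁻¹' (Φ ⁻¹' t)) :=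
      le_sup_left (a := MeasurableSpace.comap T ‹_›) _ ⟨Φ ⁻¹' t, hΦ ht, rfl⟩
    have hae : s =ᵐ[μ] T ⁻¹' (Φ ⁻¹' t) := by
      filter_upwards [hst, hinv] with x hx hx'
      refine hx.trans (propext ?_)
      change x ∈ t ↔ Φ (T x) ∈ t
      rw [hx']
    have hd := ae_eq_set.1 hae
    have heq : s = (T ⁻¹' (Φ ⁻¹' t) \ (T ⁻¹' (Φ ⁻¹' t) \ s)) ∪ (s \ T ⁻¹' (Φ ⁻¹' t)) := by
      ext x
      simp only [Set.mem_union, Set.mem_sdiff]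
      tauto
    rw [heq]
    exact (hpre.diff (hnull _ hd.2)).union (hnull _ hd.1)

end

/-- for real-valued random variables `(f_n)` with `f_{n+1}` nowhere
constant with respect to `σ(f_1,…,f_n)`, the representing functions `g_n : [0,1]^n → ℝ`
may be chosen Borel measurable, with `σ(g_1,…,g_n) = ℒ_n`, and such that for almost
every `(x_1,…,x_{n-1})` the map `x_n ↦ g_n(x_1,…,x_n)` is strictly increasing on `(0,1)`. -/
theorem statement2 {Ω : Type*} [MeasurableSpace Ω] (ℙ : Measure Ω) [IsProbabilityMeasure ℙ]
    (f : ℕ → Ω → ℝ) (hf : ∀ n, Measurable (f n))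
    (hnc : ∀ n : ℕ, ∀ h : Ω → ℝ, Measurable[sigmaUpTo ℙ f n] h →
      ℙ {ω | f n ω = h ω} = 0) :
    ∃ g : (k : ℕ) → (Fin (k + 1) → I) → ℝ,
      (∀ k, Measurable (g k)) ∧
      (∀ n : ℕ, Measure.map (fun ω (k : Fin n) => f k ω) ℙ
          = Measure.map (seqLift g n) (lamFin n)) ∧
      (∀ n : ℕ, 1 ≤ n → ∀ s : Set (Fin n → I),
        MeasurableSet[MeasurableSpace.comap (seqLift g n) MeasurableSpace.pi
            ⊔ MeasurableSpace.generateFrom {t : Set (Fin n → I) | lamFin n t = 0}] s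
          ↔ NullMeasurableSet s (lamFin n)) ∧
      (∀ k : ℕ, ∀ᵐ y ∂(lamFin k), ∀ a b : I,
        (0 : ℝ) < a → (b : ℝ) < 1 → (a : ℝ) < b →
          g k (Fin.snoc y a) < g k (Fin.snoc y b)) := by
  have hF (n : ℕ) : Measurable fun ω (k : Fin n) => f k ω :=
    measurable_pi_lambda _ fun k => hf k
  let κ : (n : ℕ) → ProbabilityTheory.Kernel (Fin n → ℝ) ℝ :=
    fun n => ProbabilityTheory.condDistrib (f n) (fun ω (k : Fin n) => f k ω) ℙ
  have : ∀ n, ProbabilityTheory.IsMarkovKernel (κ n) := fun n => by dsimp only [κ]; infer_instance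
  have hmap (n : ℕ) := map_quantileTransform ℙ hf n
  have hT (n : ℕ) := measurable_quantileTransform κ n
  have hκ (n : ℕ) : ∀ᵐ y ∂(lamFin n), ∀ t, κ n (quantileTransform κ n y) {t} = 0 := by
    have h := ae_condDistrib_singleton_eq_zero ℙ (hF n) (hf n) fun q hq => hnc n _
      (hq.comp ((comap_measurable _).mono le_sup_left le_rfl))
    rw [← hmap n] at h
    exact ae_of_ae_map (hT n).aemeasurable h
  refine ⟨fun k x => quantileTransform κ (k + 1) x (Fin.last k),
    fun k => (measurable_pi_apply _).comp (hT (k + 1)), fun n => ?_, fun n _ s => ?_, fun k => ?_⟩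
  · rw [seqLift_quantileTransform]
    exact (hmap n).symm
  · rw [seqLift_quantileTransform]
    obtain ⟨Φ, hΦ, hinv⟩ := exists_leftInverse_quantileTransform κ hκ n
    exact measurableSet_comap_sup_null_iff (hT n) hΦ hinv s
  · filter_upwards [hκ k] with y hy a b ha hb hab
    have h := quantile_lt_quantile _ hy ⟨ha, hab.trans hb⟩ ⟨ha.trans hab, hb⟩ hab
    simpa [quantileTransform] using h
end
end

section
/- Let (d_n)_{n≥1} be a Bochner integrable martingale difference sequence taking values in a Banach space X. Then there exists a sequence of Bochner measurable functions e_n : [0,1]^n → X such that (d_n) has the same law as (e_n), and such that for almost every (x_1,…,x_{n−1}) ∈ [0,1]^{n−1}, ∫_0^1 e_n(x_1,…,x_{n−1},x_n) dx_n = 0. -/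
open MeasureTheory MeasurableSpace
open scoped unitInterval

noncomputable section

section Representation

open ProbabilityTheory

section Recursion

variable {S : Type*} (f : (k : ℕ) → (Fin k → S) → I → S)

/-- The tuple whose `k`-th term is obtained by applying `f k` to the earlier terms and to the
`k`-th coordinate of the argument. -/
def recTuple : (n : ℕ) → (Fin n → I) → Fin n → S
  | 0, _ => Fin.elim0
  | n + 1, x => Fin.snoc (α := fun _ => S) (recTuple n (Fin.init x))
      (f n (recTuple n (Fin.init x)) (x (Fin.last n)))

/-- The last term of `recTuple f (k + 1)`. -/
def recTerm (k : ℕ) (x : Fin (k + 1) → I) : S :=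
  f k (recTuple f k (Fin.init x)) (x (Fin.last k))

theorem seqLift_recTerm (n : ℕ) : seqLift (recTerm f) n = recTuple f n := by
  induction n with
  | zero => funext x k; exact k.elim0
  | succ n ih =>
    funext x k
    refine Fin.lastCases ?_ (fun k => ?_) k
    · simp only [recTuple, Fin.snoc_last]
      rfl
    · simp only [recTuple, Fin.snoc_castSucc, ← ih]
      rfl

theorem recTerm_snoc (k : ℕ) (y : Fin k → I) (t : I) :
    recTerm f k (Fin.snoc (α := fun _ => I) y t) = f k (recTuple f k y) t := by
  simp only [recTerm, Fin.init_snoc, Fin.snoc_last]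

theorem recTuple_snoc (k : ℕ) (y : Fin k → I) (t : I) :
    recTuple f (k + 1) (Fin.snoc (α := fun _ => I) y t) =
      Fin.snoc (α := fun _ => S) (recTuple f k y) (f k (recTuple f k y) t) := by
  simp only [recTuple, Fin.init_snoc, Fin.snoc_last]

end Recursion

section Measurability

variable {S : Type*} [MeasurableSpace S]

theorem measurable_finSnoc (n : ℕ) :
    Measurable (fun p : (Fin n → S) × S => Fin.snoc (α := fun _ => S) p.1 p.2) := by
  refine measurable_pi_lambda _ fun k => ?_
  refine Fin.lastCases ?_ (fun k => ?_) k
  · simpa only [Fin.snoc_last] using measurable_snd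
  · simp only [Fin.snoc_castSucc]
    fun_prop

theorem measurable_finInit (n : ℕ) :
    Measurable (fun x : Fin (n + 1) → S => Fin.init (α := fun _ => S) x) :=
  measurable_pi_lambda _ fun k => measurable_pi_apply k.castSucc

variable {f : (k : ℕ) → (Fin k → S) → I → S}

theorem measurable_recTuple (hf : ∀ k, Measurable (Function.uncurry (f k))) (n : ℕ) :
    Measurable (recTuple f n) := by
  induction n with
  | zero => exact measurable_pi_lambda _ fun k => k.elim0
  | succ n ih =>
    have h := ih.comp (measurable_finInit (S := I) n)
    exact (measurable_finSnoc n).comp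
      (h.prodMk ((hf n).comp (h.prodMk (measurable_pi_apply (Fin.last n)))))

theorem measurable_recTerm (hf : ∀ k, Measurable (Function.uncurry (f k))) (k : ℕ) :
    Measurable (recTerm f k) :=
  (hf k).comp (((measurable_recTuple hf k).comp (measurable_finInit k)).prodMk
    (measurable_pi_apply (Fin.last k)))

end Measurability

instance isProbabilityMeasure_lamFin (n : ℕ) : IsProbabilityMeasure (lamFin n) := by
  unfold lamFin
  infer_instance

theorem lamFin_succ (n : ℕ) :
    lamFin (n + 1) = ((lamFin n).prod volume).map
      (fun p : (Fin n → I) × I => Fin.snoc (α := fun _ => I) p.1 p.2) := by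
  have h := ((measurePreserving_piFinSuccAbove
    (fun _ : Fin (n + 1) => (volume : Measure I)) (Fin.last n)).symm).map_eq
  have hswap : (volume : Measure I).prod (lamFin n) = ((lamFin n).prod volume).map Prod.swap :=
    Measure.prod_swap.symm
  change Measure.map _ ((volume : Measure I).prod (lamFin n)) = lamFin (n + 1) at h
  rw [← h, hswap, Measure.map_map (MeasurableEquiv.measurable _) measurable_swap]
  congr 1
  funext p
  simp [MeasurableEquiv.piFinSuccAbove_symm_apply, Fin.insertNthEquiv]

theorem compProd_eq_map_prod_of_map_eq {A B C : Type*} [MeasurableSpace A] [MeasurableSpace B]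
    [MeasurableSpace C] (ν : Measure A) [SFinite ν] (l : Measure C) [SFinite l]
    (κ : Kernel A B) [IsSFiniteKernel κ] {g : A → C → B} (hg : Measurable (Function.uncurry g))
    (h : ∀ a, l.map (g a) = κ a) :
    ν ⊗ₘ κ = (ν.prod l).map (fun p => (p.1, g p.1 p.2)) := by
  have hm : Measurable fun p : A × C => (p.1, g p.1 p.2) := measurable_fst.prodMk hg
  ext s hs
  rw [Measure.compProd_apply hs, Measure.map_apply hm hs, Measure.prod_apply (hm hs)]
  refine lintegral_congr fun a => ?_
  rw [← h a, Measure.map_apply hg.of_uncurry_left (measurable_prodMk_left hs)]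
  rfl

section Law

variable {Ω : Type*} [MeasurableSpace Ω] {P : Measure Ω} [IsProbabilityMeasure P]
  {S : Type*} [MeasurableSpace S] [StandardBorelSpace S] [Nonempty S]

theorem map_eq_map_recTuple {d : ℕ → Ω → S} (hd : ∀ n, Measurable (d n))
    {f : (k : ℕ) → (Fin k → S) → I → S} (hf : ∀ k, Measurable (Function.uncurry (f k)))
    (hfd : ∀ k h, volume.map (f k h) = condDistrib (d k) (fun ω (j : Fin k) => d j ω) P h)
    (n : ℕ) : P.map (fun ω (k : Fin n) => d k ω) = (lamFin n).map (recTuple f n) := by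
  induction n with
  | zero =>
    have h1 : (fun ω (k : Fin 0) => d k ω) = fun _ => Fin.elim0 := by
      funext ω k; exact k.elim0
    have h2 : recTuple f 0 = fun _ => Fin.elim0 := rfl
    rw [h1, h2, Measure.map_const, Measure.map_const, measure_univ, measure_univ]
  | succ n ih =>
    have hD : Measurable fun ω (k : Fin n) => d k ω := measurable_pi_lambda _ fun k => hd k
    have h1 : (fun ω (k : Fin (n + 1)) => d k ω) =
        (fun p : (Fin n → S) × S => Fin.snoc (α := fun _ => S) p.1 p.2) ∘
          fun ω => ((fun k : Fin n => d k ω), d n ω) := by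
      funext ω k
      refine Fin.lastCases ?_ (fun k => ?_) k <;> simp
    have hg : Measurable fun p : (Fin n → S) × I => (p.1, f n p.1 p.2) :=
      measurable_fst.prodMk (hf n)
    have hR := measurable_recTuple hf n
    have hprod : ((lamFin n).map (recTuple f n)).prod (volume : Measure I) =
        ((lamFin n).prod volume).map (Prod.map (recTuple f n) id) := by
      rw [← Measure.map_prod_map _ _ hR measurable_id, Measure.map_id]
    rw [h1, ← Measure.map_map (measurable_finSnoc n) (hD.prodMk (hd n)),
      ← compProd_map_condDistrib (hd n).aemeasurable,
      compProd_eq_map_prod_of_map_eq _ _ _ (hf n) (hfd n), ih, hprod, lamFin_succ,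
      Measure.map_map hg (hR.prodMap measurable_id),
      Measure.map_map (measurable_finSnoc n) (hg.comp (hR.prodMap measurable_id)),
      Measure.map_map (measurable_recTuple hf (n + 1)) (measurable_finSnoc n)]
    congr 1
    funext p
    exact (recTuple_snoc f n p.1 p.2).symm

theorem ae_integral_recTerm_eq_zero {E : Type*} [NormedAddCommGroup E] [NormedSpace ℝ E]
    [CompleteSpace E] {d : ℕ → Ω → S} (hd : ∀ n, Measurable (d n))
    {f : (k : ℕ) → (Fin k → S) → I → S} (hf : ∀ k, Measurable (Function.uncurry (f k)))
    (hfd : ∀ k h, volume.map (f k h) = condDistrib (d k) (fun ω (j : Fin k) => d j ω) P h)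
    {φ : S → E} (hφ : StronglyMeasurable φ) (k : ℕ) (hint : Integrable (fun ω => φ (d k ω)) P)
    (hzero : P[fun ω => φ (d k ω) | MeasurableSpace.pi.comap fun ω (j : Fin k) => d j ω]
      =ᵐ[P] 0) :
    ∀ᵐ y ∂lamFin k, ∫ t : I, φ (recTerm f k (Fin.snoc (α := fun _ => I) y t)) = 0 := by
  have hD : Measurable fun ω (j : Fin k) => d j ω := measurable_pi_lambda _ fun j => hd j
  have hP := (condExp_ae_eq_integral_condDistrib hD (hd k).aemeasurable hφ hint).symm.trans hzero
  have hmeas : StronglyMeasurable fun h =>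
      ∫ s, φ s ∂condDistrib (d k) (fun ω (j : Fin k) => d j ω) P h :=
    (hφ.comp_measurable measurable_snd).integral_condDistrib
  have hmap : ∀ᵐ h ∂P.map (fun ω (j : Fin k) => d j ω),
      ∫ s, φ s ∂condDistrib (d k) (fun ω (j : Fin k) => d j ω) P h = 0 :=
    (ae_map_iff hD.aemeasurable
      (hmeas.measurableSet_eq_fun stronglyMeasurable_const)).2 hP
  rw [map_eq_map_recTuple hd hf hfd k] at hmap
  filter_upwards [ae_of_ae_map (measurable_recTuple hf k).aemeasurable hmap] with y hy
  simp only [recTerm_snoc]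
  rwa [← hfd, integral_map (hf k).of_uncurry_left.aemeasurable hφ.aestronglyMeasurable] at hy

end Law

end Representation

theorem exists_isClosed_isSeparable_forall_mem {Ω X : Type*} [MeasurableSpace Ω]
    [TopologicalSpace X] [TopologicalSpace.PseudoMetrizableSpace X] {d : ℕ → Ω → X}
    (hd : ∀ n, StronglyMeasurable (d n)) :
    ∃ s : Set X, IsClosed s ∧ TopologicalSpace.IsSeparable s ∧ ∀ n ω, d n ω ∈ s :=
  ⟨closure (⋃ n, Set.range (d n)), isClosed_closure,
    (TopologicalSpace.isSeparable_iUnion.2 fun n => (hd n).isSeparable_range).closure,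
    fun n ω => subset_closure (Set.mem_iUnion.2 ⟨n, ω, rfl⟩)⟩

/-- a Bochner integrable martingale difference sequence `(d_n)` with
values in a Banach space `X` has the same law as a sequence of Bochner measurable
functions `e_n : [0,1]^n → X` satisfying `∫_0^1 e_n(x_1,…,x_{n-1},x_n) dx_n = 0` for
almost every `(x_1,…,x_{n-1})`.  (0-based indexing: `d n` is the `(n+1)`-st difference,
adapted to `ℱ (n+1)` with `E(d n | ℱ n) = 0`.) -/
theorem statement3 {Ω : Type*} [mΩ : MeasurableSpace Ω] (ℙ : Measure Ω)
    [IsProbabilityMeasure ℙ]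
    {X : Type*} [NormedAddCommGroup X] [NormedSpace ℝ X] [CompleteSpace X]
    [MeasurableSpace X] [BorelSpace X]
    (ℱ : Filtration ℕ mΩ) (d : ℕ → Ω → X)
    (hadp : ∀ n, StronglyMeasurable[ℱ (n + 1)] (d n))
    (hint : ∀ n, Integrable (d n) ℙ)
    (hmds : ∀ n, ℙ[d n|ℱ n] =ᵐ[ℙ] 0) :
    ∃ e : (k : ℕ) → (Fin (k + 1) → I) → X,
      (∀ k, StronglyMeasurable (e k)) ∧
      (∀ n : ℕ, Measure.map (fun ω (k : Fin n) => d k ω) ℙ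
          = Measure.map (seqLift e n) (lamFin n)) ∧
      (∀ k : ℕ, ∀ᵐ y ∂(lamFin k), ∫ t : I, e k (Fin.snoc y t) = 0) := by
  have hdm : ∀ n, StronglyMeasurable (d n) := fun n => (hadp n).mono (ℱ.le _)
  obtain ⟨s, hs, hsep, hmem⟩ := exists_isClosed_isSeparable_forall_mem hdm
  have : CompleteSpace s := hs.completeSpace_coe
  have : TopologicalSpace.SeparableSpace s := hsep.separableSpace
  have : SecondCountableTopology s := UniformSpace.secondCountable_of_separable s
  obtain ⟨ω₀⟩ := nonempty_of_isProbabilityMeasure ℙ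
  have : Nonempty s := ⟨⟨d 0 ω₀, hmem 0 ω₀⟩⟩
  let d' : ℕ → Ω → s := fun n ω => ⟨d n ω, hmem n ω⟩
  have hd' : ∀ n, Measurable (d' n) := fun n => (hdm n).measurable.subtype_mk
  choose f hf hfd using fun k =>
    ProbabilityTheory.Kernel.exists_measurable_map_eq_unitInterval
      (ProbabilityTheory.condDistrib (d' k) (fun ω (j : Fin k) => d' j ω) ℙ)
  have hval : StronglyMeasurable (Subtype.val : s → X) :=
    continuous_subtype_val.stronglyMeasurable
  refine ⟨fun k x => (recTerm f k x : s), fun k => hval.comp_measurable (measurable_recTerm hf k),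
    fun n => ?_, fun k => ?_⟩
  · have hv : Measurable fun (z : Fin n → s) (k : Fin n) => (z k : X) := by fun_prop
    have h := congrArg (Measure.map fun (z : Fin n → s) (k : Fin n) => (z k : X))
      (map_eq_map_recTuple hd' hf hfd n)
    rw [Measure.map_map hv (measurable_pi_lambda _ fun k => hd' k),
      Measure.map_map hv (measurable_recTuple hf n), ← seqLift_recTerm] at h
    exact h
  · refine ae_integral_recTerm_eq_zero hd' hf hfd hval k (hint k) ?_
    have hle : (MeasurableSpace.pi.comap fun ω (j : Fin k) => d' j ω) ≤ ℱ k := by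
      refine Measurable.comap_le (@measurable_pi_lambda _ _ _ (ℱ k) _ _ fun j => ?_)
      exact @Measurable.subtype_mk _ _ (ℱ k) _ _ _ ((hadp j).measurable.mono (ℱ.mono j.2) le_rfl) _
    calc ℙ[d k | MeasurableSpace.pi.comap fun ω (j : Fin k) => d' j ω]
        =ᵐ[ℙ] ℙ[ℙ[d k | ℱ k] | MeasurableSpace.pi.comap fun ω (j : Fin k) => d' j ω] :=
          (condExp_condExp_of_le hle (ℱ.le k)).symm
      _ =ᵐ[ℙ] ℙ[(0 : Ω → X) | MeasurableSpace.pi.comap fun ω (j : Fin k) => d' j ω] :=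
          condExp_congr_ae (hmds k)
      _ =ᵐ[ℙ] 0 := by rw [condExp_zero]
end
end

section
/- Let (S,𝒮,μ), (T,𝒯,ν) and (U,𝒰,τ) be measure spaces (μ, ν, τ probability measures) such that 𝒰 is separable (generated by a countable collection of sets). Let φ : S × T → U be a measurable map such that for every A ∈ 𝒮 and every C ∈ 𝒰, (μ ⊗ ν)({(s,t) : s ∈ A and φ(s,t) ∈ C}) = μ(A)·τ(C). Then for μ-almost every s ∈ S, the map t ↦ φ(s,t) is a measure preserving map from (T,ν) to (U,τ), i.e., ν({t : φ(s,t) ∈ C}) = τ(C) for all C ∈ 𝒰. -/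
open MeasureTheory MeasurableSpace

/-- Lemma 4.2: if `φ : S × T → U` is measurable, `𝒰` is countably
generated, and `(μ ⊗ ν)({(s,t) : s ∈ A, φ(s,t) ∈ C}) = μ(A)·τ(C)` for all measurable
`A ⊆ S`, `C ⊆ U`, then for `μ`-almost every `s` the section `t ↦ φ(s,t)` is a measure
preserving map from `(T,ν)` to `(U,τ)`. -/
theorem statement4 {S T U : Type*} [MeasurableSpace S] [MeasurableSpace T]
    [MeasurableSpace U] [CountablyGenerated U]
    (μ : Measure S) (ν : Measure T) (τ : Measure U)
    [IsProbabilityMeasure μ] [IsProbabilityMeasure ν] [IsProbabilityMeasure τ]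
    (φ : S × T → U) (hφ : Measurable φ)
    (h : ∀ A : Set S, ∀ C : Set U, MeasurableSet A → MeasurableSet C →
      (μ.prod ν) {p : S × T | p.1 ∈ A ∧ φ p ∈ C} = μ A * τ C) :
    ∀ᵐ s ∂μ, MeasurePreserving (fun t => φ (s, t)) ν τ := by
  have hsec (s : S) : Measurable fun t => φ (s, t) := hφ.comp measurable_prodMk_left
  have hae (C : Set U) (hC : MeasurableSet C) :
      ∀ᵐ s ∂μ, ν.map (fun t => φ (s, t)) C = τ C := by
    have heq : (fun s => ν (Prod.mk s ⁻¹' (φ ⁻¹' C))) =ᵐ[μ] fun _ => τ C := by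
      refine ae_eq_of_forall_setLIntegral_eq_of_sigmaFinite
        (measurable_measure_prodMk_left (hφ hC)) measurable_const fun A hA _ => ?_
      have hrestrict : (μ.restrict A).prod ν = (μ.prod ν).restrict (A ×ˢ Set.univ) := by
        rw [← Measure.prod_restrict, Measure.restrict_univ]
      rw [setLIntegral_const, mul_comm, ← h A C hA hC, ← Measure.prod_apply (hφ hC), hrestrict,
        Measure.restrict_apply (hφ hC)]
      congr 1
      ext p
      simp [and_comm]
    filter_upwards [heq] with s hs
    rwa [Measure.map_apply (hsec s) hC]
  let 𝒜 := generateSetAlgebra (countableGeneratingSet U)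
  have hgen : generateFrom 𝒜 = ‹MeasurableSpace U› := by
    rw [generateFrom_generateSetAlgebra_eq, generateFrom_countableGeneratingSet]
  have hall : ∀ᵐ s ∂μ, ∀ C ∈ 𝒜, ν.map (fun t => φ (s, t)) C = τ C :=
    (ae_ball_iff (countable_generateSetAlgebra countable_countableGeneratingSet)).2
      fun C hC => hae C (hgen ▸ measurableSet_generateFrom hC)
  filter_upwards [hall] with s hs
  have := Measure.isProbabilityMeasure_map (μ := ν) (hsec s).aemeasurable
  exact ⟨hsec s, ext_of_generate_finite 𝒜 hgen.symm
    isSetAlgebra_generateSetAlgebra.isSetRing.isSetSemiring.isPiSystem hs (by simp)⟩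
end

section
/- Let X be a separable Banach space, let (ℱ_n)_{n≥0} be a filtration with ℱ_0 trivial, and let (f_n) be an X-valued Bochner integrable martingale difference sequence with respect to (ℱ_n) that satisfies condition (C.I.). Then the representing functions h_n : [0,1]^n → X (with u_n((x_m),(y_m)) = h_n(x_1,…,x_{n−1},y_n) and (f_n), (h_n), (u_n) all of the same law) may be chosen so that, in addition, ∫_0^1 h_n(x_1,…,x_{n−1},x_n) dx_n = 0 for almost every (x_1,…,x_{n−1}). -/
open MeasureTheory MeasurableSpace
open scoped unitInterval

noncomputable section

/-- The first `n` terms of the sequence `u_m((x_j),(y_j)) = h_m(x_1,…,x_{m-1},y_m)`,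
as a map `[0,1]^n × [0,1]^n → S^n` (only the displayed coordinates are used). -/
def uLift {S : Type*} (h : (k : ℕ) → (Fin (k + 1) → I) → S) (n : ℕ) :
    (Fin n → I) × (Fin n → I) → Fin n → S :=
  fun p k => h k (Fin.snoc (fun j : Fin k => p.1 ⟨j.1, lt_trans j.2 k.2⟩) (p.2 k))

/-- Real-valued indicator `1_{h ∈ A}`. -/
def ind {Ω S : Type*} (A : Set S) (h : Ω → S) : Ω → ℝ :=
  fun ω => A.indicator (fun _ => (1 : ℝ)) (h ω)

open ProbabilityTheory (condDistrib condDistrib_ae_eq_condExp compProd_map_condDistrib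
  condExp_ae_eq_integral_condDistrib)

/-- The map `[0,1]^n → S^n` whose `k`-th value is obtained by applying `G k` to the previous
values and to the `k`-th coordinate. -/
def recMap {S : Type*} (G : (n : ℕ) → (Fin n → S) → I → S) : (n : ℕ) → (Fin n → I) → Fin n → S
  | 0, _ => Fin.elim0
  | n + 1, x => Fin.snoc (α := fun _ => S) (recMap G n (Fin.init x))
      (G n (recMap G n (Fin.init x)) (x (Fin.last n)))

/-- The last value of `recMap`. -/
def recFun {S : Type*} (G : (n : ℕ) → (Fin n → S) → I → S) (k : ℕ) (x : Fin (k + 1) → I) : S :=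
  G k (recMap G k (Fin.init x)) (x (Fin.last k))

lemma seqLift_recFun {S : Type*} (G : (n : ℕ) → (Fin n → S) → I → S) (n : ℕ) :
    seqLift (recFun G) n = recMap G n := by
  induction n with
  | zero => funext x k; exact k.elim0
  | succ n ih =>
    funext x k
    refine Fin.lastCases ?_ (fun i => ?_) k
    · simp only [recMap, Fin.snoc_last]
      rfl
    · simp only [recMap, Fin.snoc_castSucc]
      exact congrFun (congrFun ih (Fin.init x)) i

instance inst_s8 (n : ℕ) : IsProbabilityMeasure (lamFin n) := by
  unfold lamFin; infer_instance

lemma measurable_snoc {S : Type*} [MeasurableSpace S] (n : ℕ) :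
    Measurable (fun p : (Fin n → S) × S => (Fin.snoc p.1 p.2 : Fin (n + 1) → S)) := by
  refine measurable_pi_iff.2 fun k => ?_
  refine Fin.lastCases ?_ (fun i => ?_) k
  · simpa only [Fin.snoc_last] using measurable_snd
  · simp only [Fin.snoc_castSucc]
    exact (measurable_pi_apply i).comp measurable_fst

lemma measurable_init {S : Type*} [MeasurableSpace S] (n : ℕ) :
    Measurable (fun x : Fin (n + 1) → S => (Fin.init x : Fin n → S)) :=
  measurable_pi_iff.2 fun k => measurable_pi_apply k.castSucc

lemma map_snoc_lamFin (n : ℕ) :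
    Measure.map (fun p : (Fin n → I) × I => (Fin.snoc p.1 p.2 : Fin (n + 1) → I))
      ((lamFin n).prod volume) = lamFin (n + 1) := by
  refine (Measure.pi_eq fun s hs => ?_).symm
  rw [Measure.map_apply (measurable_snoc n) (MeasurableSet.univ_pi hs)]
  have : (fun p : (Fin n → I) × I => (Fin.snoc p.1 p.2 : Fin (n + 1) → I)) ⁻¹' Set.univ.pi s
      = (Set.univ.pi fun i : Fin n => s i.castSucc) ×ˢ s (Fin.last n) := by
    ext p
    simp [Fin.forall_fin_succ', Set.mem_pi]
  rw [this, Measure.prod_prod, lamFin, Measure.pi_pi, Fin.prod_univ_castSucc]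

lemma measurable_recMap {S : Type*} [MeasurableSpace S] {G : (n : ℕ) → (Fin n → S) → I → S}
    (hG : ∀ n, Measurable (Function.uncurry (G n))) (n : ℕ) : Measurable (recMap G n) := by
  induction n with
  | zero => exact measurable_pi_iff.2 fun k => k.elim0
  | succ n ih =>
    have h1 := ih.comp (measurable_init (S := I) n)
    exact (measurable_snoc n).comp
      (h1.prodMk ((hG n).comp (h1.prodMk (measurable_pi_apply (Fin.last n)))))

lemma measurable_recFun {S : Type*} [MeasurableSpace S] {G : (n : ℕ) → (Fin n → S) → I → S}
    (hG : ∀ n, Measurable (Function.uncurry (G n))) (k : ℕ) : Measurable (recFun G k) :=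
  (hG k).comp (((measurable_recMap hG k).comp (measurable_init k)).prodMk
    (measurable_pi_apply (Fin.last k)))

lemma map_recMap {Ω S : Type*} [MeasurableSpace Ω] [MeasurableSpace S] (μ : Measure Ω)
    [IsProbabilityMeasure μ] {Z : ℕ → Ω → S} (hZ : ∀ n, Measurable (Z n))
    {G : (n : ℕ) → (Fin n → S) → I → S} (hG : ∀ n, Measurable (Function.uncurry (G n)))
    [StandardBorelSpace S] [Nonempty S]
    (hGZ : ∀ n z, Measure.map (G n z) volume
      = condDistrib (Z n) (fun ω (k : Fin n) => Z k ω) μ z) (n : ℕ) :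
    Measure.map (recMap G n) (lamFin n) = Measure.map (fun ω (k : Fin n) => Z k ω) μ := by
  have hpast : ∀ n, Measurable (fun ω (k : Fin n) => Z k ω) :=
    fun n => measurable_pi_iff.2 fun k => hZ k
  induction n with
  | zero =>
    have := Measure.isProbabilityMeasure_map (μ := lamFin 0) (measurable_recMap hG 0).aemeasurable
    have := Measure.isProbabilityMeasure_map (μ := μ) (hpast 0).aemeasurable
    refine Measure.ext fun s _ => ?_
    rcases Set.eq_empty_or_nonempty s with rfl | hs
    · simp
    · rw [Subsingleton.eq_univ_of_nonempty hs, measure_univ, measure_univ]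
  | succ n ih =>
    have hpair : Measurable fun p : (Fin n → S) × I => (p.1, G n p.1 p.2) :=
      measurable_fst.prodMk (hG n)
    have hjoint : Measure.map (fun p : (Fin n → S) × I => (p.1, G n p.1 p.2))
        ((Measure.map (fun ω (k : Fin n) => Z k ω) μ).prod volume)
        = Measure.map (fun ω => (fun k : Fin n => Z k ω, Z n ω)) μ := by
      have := Measure.isProbabilityMeasure_map (μ := μ) (hpast n).aemeasurable
      rw [← compProd_map_condDistrib (hZ n).aemeasurable]
      ext s hs
      rw [Measure.map_apply hpair hs, Measure.prod_apply (hpair hs), Measure.compProd_apply hs]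
      refine lintegral_congr fun z => ?_
      rw [← hGZ n z, Measure.map_apply (hG n).of_uncurry_left (measurable_prodMk_left hs)]
      rfl
    have hmul : (Measure.map (recMap G n) (lamFin n)).prod (volume : Measure I)
        = Measure.map (Prod.map (recMap G n) id) ((lamFin n).prod volume) := by
      rw [← Measure.map_prod_map _ _ (measurable_recMap hG n) measurable_id, Measure.map_id]
    have hR : (fun ω (k : Fin (n + 1)) => Z k ω)
        = (fun p : (Fin n → S) × S => (Fin.snoc p.1 p.2 : Fin (n + 1) → S))
          ∘ fun ω => (fun k : Fin n => Z k ω, Z n ω) := by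
      funext ω k
      refine Fin.lastCases ?_ (fun i => ?_) k <;> simp
    rw [hR, ← Measure.map_map (measurable_snoc n) ((hpast n).prodMk (hZ n)), ← hjoint, ← ih, hmul,
      Measure.map_map hpair ((measurable_recMap hG n).prodMap measurable_id),
      Measure.map_map (measurable_snoc n)
        (hpair.comp ((measurable_recMap hG n).prodMap measurable_id)),
      ← map_snoc_lamFin, Measure.map_map (measurable_recMap hG _) (measurable_snoc n)]
    congr 1
    funext p
    simp [recMap]

/-- A countably generated σ-algebra is generated by a sequence of sets forming a π-system that
contains the whole space. -/
lemma exists_countable_isPiSystem (X : Type*) [mX : MeasurableSpace X] [CountablyGenerated X] :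
    ∃ A : ℕ → Set X, IsPiSystem (Set.range A) ∧ Set.univ ∈ Set.range A ∧
      mX = generateFrom (Set.range A) := by
  obtain ⟨b, hb, hgen⟩ := CountablyGenerated.isCountablyGenerated (α := X)
  have hc := countable_generateSetAlgebra hb
  have halg := isSetAlgebra_generateSetAlgebra (𝒜 := b)
  obtain ⟨A, hA⟩ := hc.exists_eq_range ⟨_, halg.univ_mem⟩
  refine ⟨A, ?_, ?_, ?_⟩
  · rw [← hA]
    exact fun s hs t ht _ => halg.inter_mem hs ht
  · rw [← hA]
    exact halg.univ_mem
  · rw [← hA, generateFrom_generateSetAlgebra_eq, hgen]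

/-- If `V` is a conditional expectation of `g` given a σ-algebra `m₂` and is measurable for a
smaller σ-algebra `m₁`, then it is also the conditional expectation of `g` given `m₁`. -/
lemma condExp_eq_condExp_of_le {Ω E : Type*} [NormedAddCommGroup E] [NormedSpace ℝ E]
    [CompleteSpace E] {m₁ m₂ m : MeasurableSpace Ω} {μ : Measure Ω} [IsFiniteMeasure μ]
    {g V : Ω → E} (h12 : m₁ ≤ m₂) (h2 : m₂ ≤ m) (hV : StronglyMeasurable[m₁] V)
    (hgV : μ[g|m₂] =ᵐ[μ] V) : μ[g|m₁] =ᵐ[μ] V :=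
  calc μ[g|m₁] =ᵐ[μ] μ[μ[g|m₂]|m₁] := (condExp_condExp_of_le h12 h2).symm
    _ =ᵐ[μ] μ[V|m₁] := condExp_congr_ae hgV
    _ = V := condExp_of_stronglyMeasurable (h12.trans h2) hV (integrable_condExp.congr hgV)

/-- The mass that the law of `uLift` gives to a box, for functions of the form `p ∘ recFun G k`. -/
lemma map_uLift_pi {S X : Type*} [MeasurableSpace S] [MeasurableSpace X]
    {G : (n : ℕ) → (Fin n → S) → I → S} (hG : ∀ n, Measurable (Function.uncurry (G n)))
    {p : S → X} (hp : Measurable p) (n : ℕ) {A : Fin n → Set X}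
    (hA : ∀ i, MeasurableSet (A i)) :
    Measure.map (uLift (fun k x => p (recFun G k x)) n) ((lamFin n).prod (lamFin n))
        (Set.univ.pi A)
      = ∫⁻ x, ∏ i : Fin n, Measure.map (G i (fun j => recMap G n x ⟨j.1, lt_trans j.2 i.2⟩)) volume
          (p ⁻¹' A i) ∂(lamFin n) := by
  have hm : Measurable (uLift (fun k x => p (recFun G k x)) n) := by
    refine measurable_pi_iff.2 fun k => ?_
    have h1 : Measurable fun q : (Fin n → I) × (Fin n → I) =>
        ((fun j => q.1 ⟨j.1, lt_trans j.2 k.2⟩ : Fin k → I), q.2 k) :=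
      Measurable.prodMk (measurable_pi_iff.2 fun j => (measurable_pi_apply _).comp measurable_fst)
        ((measurable_pi_apply _).comp measurable_snd)
    exact (hp.comp (measurable_recFun hG k)).comp ((measurable_snoc (k : ℕ)).comp h1)
  have hbox := MeasurableSet.univ_pi hA
  rw [Measure.map_apply hm hbox, Measure.prod_apply (hm hbox)]
  refine lintegral_congr fun x => ?_
  have hset : Prod.mk x ⁻¹' (uLift (fun k x => p (recFun G k x)) n ⁻¹' Set.univ.pi A)
      = Set.univ.pi fun i : Fin n =>
        G i (fun j => recMap G n x ⟨j.1, lt_trans j.2 i.2⟩) ⁻¹' (p ⁻¹' A i) := by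
    ext y
    simp only [Set.mem_preimage, Set.mem_pi, Set.mem_univ, true_imp_iff, uLift, recFun,
      Fin.init_snoc, Fin.snoc_last, ← seqLift_recFun]
    rfl
  rw [hset, lamFin, Measure.pi_pi]
  refine Finset.prod_congr rfl fun i _ => ?_
  rw [Measure.map_apply (hG i).of_uncurry_left (hp (hA i))]

/-- if moreover `X` is a separable Banach space and `(f_n)` is a
Bochner integrable martingale difference sequence satisfying condition (C.I.), the
representing functions `h_n` of Statement 7 may be chosen so that in addition
`∫_0^1 h_n(x_1,…,x_{n-1},x_n) dx_n = 0` for almost every `(x_1,…,x_{n-1})`. -/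
theorem statement8 {Ω : Type*} [mΩ : MeasurableSpace Ω] (ℙ : Measure Ω)
    [IsProbabilityMeasure ℙ]
    {X : Type*} [NormedAddCommGroup X] [NormedSpace ℝ X] [CompleteSpace X]
    [TopologicalSpace.SeparableSpace X] [MeasurableSpace X] [BorelSpace X]
    (ℱ : Filtration ℕ mΩ) (hℱ0 : ℱ 0 = ⊥)
    (f : ℕ → Ω → X)
    (hfa : ∀ n, StronglyMeasurable[ℱ (n + 1)] (f n))
    (hfint : ∀ n, Integrable (f n) ℙ)
    (hmds : ∀ n, ℙ[f n|ℱ n] =ᵐ[ℙ] 0)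
    (hCI : ∃ 𝒢 : MeasurableSpace Ω, 𝒢 ≤ mΩ ∧
      (∀ n : ℕ, ∀ A : Set X, MeasurableSet A →
        ℙ[ind A (f n)|ℱ n] =ᵐ[ℙ] ℙ[ind A (f n)|𝒢]) ∧
      (∀ n : ℕ, ∀ A : Fin n → Set X, (∀ i, MeasurableSet (A i)) →
        ℙ[(fun ω => ∏ i : Fin n, ind (A i) (f i) ω)|𝒢]
          =ᵐ[ℙ] fun ω => ∏ i : Fin n, (ℙ[ind (A i) (f i)|𝒢]) ω)) :
    ∃ h : (k : ℕ) → (Fin (k + 1) → I) → X,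
      (∀ k, StronglyMeasurable (h k)) ∧
      (∀ n : ℕ, Measure.map (fun ω (k : Fin n) => f k ω) ℙ
          = Measure.map (seqLift h n) (lamFin n)) ∧
      (∀ n : ℕ, Measure.map (fun ω (k : Fin n) => f k ω) ℙ
          = Measure.map (uLift h n) ((lamFin n).prod (lamFin n))) ∧
      (∀ k : ℕ, ∀ᵐ y ∂(lamFin k), ∫ t : I, h k (Fin.snoc y t) = 0) := by
  have hCI' : ∀ (n : ℕ) (B : Fin n → Set X), (∀ i, MeasurableSet (B i)) →
      ∫ ω, ∏ i : Fin n, ind (B i) (f i) ω ∂ℙ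
        = ∫ ω, ∏ i : Fin n, (ℙ[ind (B i) (f i)|ℱ i]) ω ∂ℙ := by
    intro n B hB
    obtain ⟨𝒢, h𝒢, hlaw, hindep⟩ := hCI
    rw [← integral_condExp h𝒢]
    refine integral_congr_ae ((hindep n B hB).trans ?_)
    filter_upwards [ae_all_iff.2 fun i : Fin n => hlaw i (B i) (hB i)] with ω hω
    exact Finset.prod_congr rfl fun i _ => (hω i).symm
  have : SecondCountableTopology X := UniformSpace.secondCountable_of_separable X
  obtain ⟨A, hApi, hAuniv, hAgen⟩ := exists_countable_isPiSystem X
  have hA : ∀ j, MeasurableSet (A j) := fun j => by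
    rw [hAgen]; exact measurableSet_generateFrom ⟨j, rfl⟩
  have hfm : ∀ n, Measurable (f n) := fun n => ((hfa n).mono (ℱ.le _)).measurable
  let Z : ℕ → Ω → X × (ℕ → ℝ) :=
    fun n ω => (f n ω, fun j => (ℙ[ind (A j) (f (n + 1))|ℱ (n + 1)]) ω)
  have hZa : ∀ n, Measurable[ℱ (n + 1)] (Z n) := fun n =>
    (hfa n).measurable.prodMk
      ((@measurable_pi_iff _ _ _ (ℱ (n + 1)) _ _).2 fun j =>
        stronglyMeasurable_condExp.measurable)
  have hZ : ∀ n, Measurable (Z n) := fun n => (hZa n).mono (ℱ.le _) le_rfl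
  let past : (n : ℕ) → Ω → Fin n → X × (ℕ → ℝ) := fun n ω k => Z k ω
  have hpast : ∀ n, Measurable (past n) := fun n => measurable_pi_iff.2 fun k => hZ k
  have hcomap : ∀ n, MeasurableSpace.comap (past n) inferInstance ≤ ℱ n := fun n => by
    refine Measurable.comap_le ?_
    exact (@measurable_pi_iff _ _ _ (ℱ n) _ _).2 fun k => (hZa k).mono (ℱ.mono k.2) le_rfl
  choose G hG hGmap using fun n =>
    (condDistrib (Z n) (past n) ℙ).exists_measurable_map_eq_unitInterval
  have hrec : ∀ n, Measure.map (recMap G n) (lamFin n) = Measure.map (past n) ℙ :=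
    map_recMap ℙ hZ hG hGmap
  have hcond : ∀ n j, (fun ω => (condDistrib (Z n) (past n) ℙ (past n ω)).real
      (Prod.fst ⁻¹' A j)) =ᵐ[ℙ] ℙ[ind (A j) (f n)|ℱ n] := by
    intro n j
    refine (condDistrib_ae_eq_condExp (hpast n) (hZ n) (measurable_fst (hA j))).trans
      (condExp_eq_condExp_of_le (hcomap n) (ℱ.le n) ?_ Filter.EventuallyEq.rfl)
    cases n with
    | zero =>
      have h0 : StronglyMeasurable[⊥] (ℙ[ind (A j) (f 0)|ℱ 0]) := by
        rw [← hℱ0]; exact stronglyMeasurable_condExp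
      exact h0.mono bot_le
    | succ m =>
      refine Measurable.stronglyMeasurable ?_
      have hq : Measurable fun z : Fin (m + 1) → X × (ℕ → ℝ) => (z (Fin.last m)).2 j :=
        (measurable_pi_apply j).comp (measurable_snd.comp (measurable_pi_apply _))
      exact hq.comp (comap_measurable (past (m + 1)))
  have hZf : ∀ n, Measurable fun z : Fin n → X × (ℕ → ℝ) => fun k => (z k).1 := fun n =>
    measurable_pi_iff.2 fun k => measurable_fst.comp (measurable_pi_apply k)
  refine ⟨fun k x => (recFun G k x).1, fun k =>
    (measurable_fst.comp (measurable_recFun hG k)).stronglyMeasurable, fun n => ?_, fun n => ?_,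
    fun k => ?_⟩
  · have h1 : seqLift (fun k x => (recFun G k x).1) n
        = (fun z : Fin n → X × (ℕ → ℝ) => fun k => (z k).1) ∘ recMap G n := by
      rw [← seqLift_recFun]; rfl
    rw [h1, ← Measure.map_map (hZf n) (measurable_recMap hG n), hrec n,
      Measure.map_map (hZf n) (hpast n)]
    rfl
  · have hfn : Measurable fun ω (k : Fin n) => f k ω := measurable_pi_iff.2 fun k => hfm k
    have := Measure.isProbabilityMeasure_map (μ := ℙ) hfn.aemeasurable
    have hspan : IsCountablySpanning (Set.range A) :=
      ⟨fun _ => Set.univ, fun _ => hAuniv, Set.iUnion_const _⟩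
    refine Measure.ext_of_generateFrom_of_iUnion _ (fun _ => Set.univ)
      (generateFrom_eq_pi (fun _ => hAgen.symm) (fun _ => hspan)).symm
      (IsPiSystem.pi fun _ => hApi) (Set.iUnion_const _)
      (fun _ => ⟨fun _ => Set.univ, fun _ _ => hAuniv, Set.pi_univ _⟩)
      (fun _ => measure_ne_top _ _) ?_
    rintro _ ⟨B, hB, rfl⟩
    choose j hj using fun i => hB i (Set.mem_univ i)
    obtain rfl : (fun i => A (j i)) = B := funext hj
    have hu := map_uLift_pi hG (p := Prod.fst) measurable_fst n (fun i => hA (j i))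
    simp only [hGmap] at hu
    let Φ : (Fin n → X × (ℕ → ℝ)) → ENNReal := fun z => ∏ i : Fin n,
      condDistrib (Z i) (past i) ℙ (fun k => z ⟨k.1, lt_trans k.2 i.2⟩) (Prod.fst ⁻¹' A (j i))
    have hΦ : Measurable Φ := by
      refine Finset.measurable_prod _ fun i _ => ?_
      exact (ProbabilityTheory.Kernel.measurable_coe _ (measurable_fst (hA (j i)))).comp
        (measurable_pi_iff.2 fun k => measurable_pi_apply _)
    have hstep : ∫⁻ x, Φ (recMap G n x) ∂(lamFin n) = ∫⁻ ω, Φ (past n ω) ∂ℙ := by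
      rw [← lintegral_map hΦ (measurable_recMap hG n), hrec n, lintegral_map hΦ (hpast n)]
    refine Eq.trans ?_ (hstep.symm.trans hu.symm)
    have hprod : ∀ ω, ∏ i : Fin n, ind (A (j i)) (f i) ω
        = ((fun ω (k : Fin n) => f k ω) ⁻¹' Set.univ.pi fun i => A (j i)).indicator 1 ω := by
      intro ω
      by_cases hω : ∀ i : Fin n, f i ω ∈ A (j i)
      · rw [Set.indicator_of_mem (by simpa using hω)]
        simp [ind, hω]
      · rw [Set.indicator_of_notMem (by simpa using hω)]
        obtain ⟨i, hi⟩ := not_forall.1 hω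
        exact Finset.prod_eq_zero (Finset.mem_univ i) (by simp [ind, hi])
    have hbox := hfn (MeasurableSet.univ_pi fun i => hA (j i))
    have hreal : ℙ.real ((fun ω (k : Fin n) => f k ω) ⁻¹' Set.univ.pi fun i => A (j i))
        = ∫ ω, (Φ (past n ω)).toReal ∂ℙ := by
      rw [← integral_indicator_one hbox, ← integral_congr_ae (.of_forall hprod),
        hCI' n _ fun i => hA (j i)]
      refine integral_congr_ae ?_
      filter_upwards [ae_all_iff.2 fun i : Fin n => hcond i (j i)] with ω hω
      rw [ENNReal.toReal_prod]
      exact Finset.prod_congr rfl fun i _ => (hω i).symm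
    have hΦ1 : ∀ z, Φ z ≤ 1 := fun z => Finset.prod_le_one' fun i _ => prob_le_one
    have hΦfin : ∫⁻ ω, Φ (past n ω) ∂ℙ ≠ ⊤ :=
      ((lintegral_mono fun ω => hΦ1 (past n ω)).trans_lt (by simp)).ne
    rw [integral_toReal (f := fun ω => Φ (past n ω)) (hΦ.comp (hpast n)).aemeasurable
      (.of_forall fun ω => (hΦ1 _).trans_lt ENNReal.one_lt_top)] at hreal
    rw [Measure.map_apply hfn (MeasurableSet.univ_pi fun i => hA (j i))]
    exact (ENNReal.toReal_eq_toReal_iff' (measure_ne_top _ _) hΦfin).1 hreal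
  · have hint : ∀ᵐ ω ∂ℙ, ∫ z, z.1 ∂(condDistrib (Z k) (past k) ℙ (past k ω)) = 0 := by
      have h1 := condExp_ae_eq_integral_condDistrib (μ := ℙ) (hpast k)
        (hZ k).aemeasurable (f := Prod.fst) measurable_fst.stronglyMeasurable (hfint k)
      have h2 := condExp_eq_condExp_of_le (hcomap k) (ℱ.le k) stronglyMeasurable_zero (hmds k)
      filter_upwards [h1, h2] with ω hω1 hω2
      exact hω1.symm.trans hω2
    have hms : MeasurableSet {z : Fin k → X × (ℕ → ℝ) |
        ∫ w, w.1 ∂(condDistrib (Z k) (past k) ℙ z) = 0} := by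
      have : StronglyMeasurable fun z : Fin k → X × (ℕ → ℝ) =>
          ∫ w, w.1 ∂(condDistrib (Z k) (past k) ℙ z) :=
        StronglyMeasurable.integral_condDistrib
          (f := fun q : (Fin k → X × (ℕ → ℝ)) × (X × (ℕ → ℝ)) => q.2.1)
          (measurable_fst.comp measurable_snd).stronglyMeasurable
      exact this.measurable (measurableSet_singleton 0)
    have h3 : ∀ᵐ y ∂(lamFin k),
        ∫ w, w.1 ∂(condDistrib (Z k) (past k) ℙ (recMap G k y)) = 0 := by
      refine (ae_map_iff (measurable_recMap hG k).aemeasurable hms).1 ?_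
      rw [hrec k]
      exact (ae_map_iff (hpast k).aemeasurable hms).2 hint
    filter_upwards [h3] with y hy
    rw [← hGmap, integral_map (hG k).of_uncurry_left.aemeasurable
      measurable_fst.stronglyMeasurable.aestronglyMeasurable] at hy
    simpa only [recFun, Fin.init_snoc, Fin.snoc_last] using hy
end
end

section
/- Let X be a Banach space, let 1 < p < ∞, and suppose there is a constant c > 0 such that for every Bochner integrable X-valued martingale difference sequence (d_n) and every choice of signs ε_n = ±1 one has ‖Σ_{n=1}^N ε_n d_n‖_{L_p(X)} ≤ c ‖Σ_{n=1}^N d_n‖_{L_p(X)} (i.e., X is UMD with constant c in L_p). Then there is a constant C, depending only on c (hence only on X and p), such that for every filtration (ℱ_n)_{n≥0} with ℱ_0 trivial and every pair of X-valued Bochner integrable martingale difference sequences (f_n) and (g_n) adapted to (ℱ_n) that are tangent to each other, one has ‖Σ_{n=1}^N g_n‖_{L_p(X)} ≤ C ‖Σ_{n=1}^N f_n‖_{L_p(X)} for all N. -/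
open MeasureTheory MeasurableSpace
open scoped ENNReal NNReal

noncomputable section

section Decoupling

open ProbabilityTheory unitInterval

section CondExp

variable {Ω E : Type*} [NormedAddCommGroup E] [NormedSpace ℝ E] [CompleteSpace E]

lemma condExp_ae_eq_zero_of_forall_setIntegral_eq_zero {m m0 : MeasurableSpace Ω} (hm : m ≤ m0)
    {μ : Measure Ω} [IsFiniteMeasure μ] {f : Ω → E} (hf : Integrable f μ)
    (h : ∀ s, MeasurableSet[m] s → ∫ x in s, f x ∂μ = 0) : μ[f|m] =ᵐ[μ] 0 :=
  (ae_eq_condExp_of_forall_setIntegral_eq hm hf (fun _ _ _ => integrableOn_zero)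
    (fun s hs _ => by simp [h s hs]) aestronglyMeasurable_zero).symm

lemma setIntegral_eq_zero_of_condExp_ae_eq_zero {m m0 : MeasurableSpace Ω} (hm : m ≤ m0)
    {μ : Measure Ω} [IsFiniteMeasure μ] {f : Ω → E} (hf : Integrable f μ)
    (h : μ[f|m] =ᵐ[μ] 0) {s : Set Ω} (hs : MeasurableSet[m] s) : ∫ x in s, f x ∂μ = 0 := by
  rw [← setIntegral_condExp hm hf hs,
    setIntegral_congr_ae (g := 0) (hm _ hs) (h.mono fun _ h _ => h)]
  simp

end CondExp

section Exchangeable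

variable {Ω Γ E : Type*} [NormedAddCommGroup E] [NormedSpace ℝ E] [CompleteSpace E]
  [SecondCountableTopology E] [MeasurableSpace E] [BorelSpace E]
  {mΩ : MeasurableSpace Ω} [MeasurableSpace Γ] {P : Measure Ω}
  {Y : Ω → Γ} {f h : Ω → E}

/-- `f` and `h` are exchangeable conditionally on `Y`. -/
def CondExchangeable (P : Measure Ω) (Y : Ω → Γ) (f h : Ω → E) : Prop :=
  P.map (fun ω => (Y ω, f ω, h ω)) = P.map (fun ω => (Y ω, h ω, f ω))

omit [NormedAddCommGroup E] [NormedSpace ℝ E] [CompleteSpace E] [SecondCountableTopology E]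
  [BorelSpace E] in
lemma CondExchangeable.map_eq (hY : Measurable Y) (hf : Measurable f) (hh : Measurable h)
    (H : CondExchangeable P Y f h) :
    P.map (fun ω => (Y ω, f ω)) = P.map (fun ω => (Y ω, h ω)) := by
  have := congrArg (Measure.map fun z : Γ × E × E => (z.1, z.2.1)) H
  rwa [Measure.map_map (by fun_prop) (by fun_prop), Measure.map_map (by fun_prop) (by fun_prop)]
    at this

omit [CompleteSpace E] in
lemma setIntegral_preimage_eq_of_map_eq (hY : Measurable Y) (hf : Measurable f)
    (hh : Measurable h) (H : P.map (fun ω => (Y ω, f ω)) = P.map (fun ω => (Y ω, h ω)))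
    {T : Set Γ} (hT : MeasurableSet T) :
    ∫ ω in Y ⁻¹' T, f ω ∂P = ∫ ω in Y ⁻¹' T, h ω ∂P := by
  have key : ∀ k : Ω → E, Measurable k →
      ∫ ω in Y ⁻¹' T, k ω ∂P = ∫ z in T ×ˢ Set.univ, z.2 ∂P.map (fun ω => (Y ω, k ω)) := by
    intro k hk
    rw [setIntegral_map (hT.prod .univ) measurable_snd.aestronglyMeasurable (by fun_prop)]
    congr 2
    ext ω
    simp
  rw [key f hf, key h hh, H]

variable [IsFiniteMeasure P]

omit [NormedSpace ℝ E] [CompleteSpace E] [SecondCountableTopology E] [IsFiniteMeasure P] in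
lemma CondExchangeable.integrable (hY : Measurable Y) (hf : Measurable f) (hh : Measurable h)
    (H : CondExchangeable P Y f h) (hfi : Integrable f P) : Integrable h P := by
  have H' : P.map f = P.map h := by
    have := congrArg (Measure.map Prod.snd) (H.map_eq hY hf hh)
    rwa [Measure.map_map (by fun_prop) (by fun_prop),
      Measure.map_map (by fun_prop) (by fun_prop)] at this
  exact (IdentDistrib.mk hf.aemeasurable hh.aemeasurable H').integrable_iff.1 hfi

lemma CondExchangeable.condExp_ae_eq_zero (hY : Measurable Y) (hf : Measurable f)
    (hh : Measurable h) (H : CondExchangeable P Y f h) (hfi : Integrable f P)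
    (hf0 : P[f|MeasurableSpace.comap Y inferInstance] =ᵐ[P] 0) :
    P[h|MeasurableSpace.comap Y inferInstance] =ᵐ[P] 0 := by
  refine condExp_ae_eq_zero_of_forall_setIntegral_eq_zero hY.comap_le
    (H.integrable hY hf hh hfi) ?_
  rintro _ ⟨T, hT, rfl⟩
  rw [← setIntegral_preimage_eq_of_map_eq hY hf hh (H.map_eq hY hf hh) hT]
  exact setIntegral_eq_zero_of_condExp_ae_eq_zero hY.comap_le hfi hf0 ⟨T, hT, rfl⟩

lemma CondExchangeable.condExp_sub_ae_eq_zero (hY : Measurable Y) (hf : Measurable f)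
    (hh : Measurable h) (H : CondExchangeable P Y f h) (hfi : Integrable f P) :
    P[f - h|MeasurableSpace.comap (fun ω => (Y ω, f ω + h ω)) inferInstance] =ᵐ[P] 0 := by
  have hYs : Measurable fun ω => (Y ω, f ω + h ω) := by fun_prop
  refine condExp_ae_eq_zero_of_forall_setIntegral_eq_zero hYs.comap_le
    (hfi.sub (H.integrable hY hf hh hfi)) ?_
  rintro _ ⟨T, hT, rfl⟩
  let S : Set (Γ × E × E) := (fun z => (z.1, z.2.1 + z.2.2)) ⁻¹' T
  have hS : MeasurableSet S := by
    have : Measurable fun z : Γ × E × E => (z.1, z.2.1 + z.2.2) := by fun_prop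
    exact this hT
  have key : ∀ k l : Ω → E, Measurable k → Measurable l →
      ∫ z in S, (z.2.1 - z.2.2) ∂P.map (fun ω => (Y ω, k ω, l ω))
        = ∫ ω in (fun ω => (Y ω, k ω + l ω)) ⁻¹' T, (k ω - l ω) ∂P := by
    intro k l hk hl
    have hm : Measurable fun z : Γ × E × E => z.2.1 - z.2.2 := by fun_prop
    rw [setIntegral_map hS hm.aestronglyMeasurable (by fun_prop)]
    rfl
  have h1 := key f h hf hh
  rw [H, key h f hh hf] at h1
  simp_rw [add_comm (h _) (f _)] at h1
  have h2 : ∀ ω, h ω - f ω = -(f ω - h ω) := fun ω => by abel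
  simp_rw [h2, integral_neg] at h1
  have h3 : (2 : ℝ) • ∫ ω in (fun ω => (Y ω, f ω + h ω)) ⁻¹' T, (f ω - h ω) ∂P = 0 := by
    rw [two_smul]
    nth_rewrite 1 [← h1]
    simp
  exact (smul_eq_zero.1 h3).resolve_left two_ne_zero

end Exchangeable

section Coupling

variable {Ω Ω₂ Γ V E : Type*} [MeasurableSpace Ω] [MeasurableSpace Ω₂] [MeasurableSpace Γ]
  [MeasurableSpace V] [MeasurableSpace E] {P : Measure Ω} [IsProbabilityMeasure P]
  {ν : Measure Ω₂} [IsProbabilityMeasure ν]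

/-- If `w` is uniform and independent of `v`, and `φ (π ω)` pushes the uniform law to the
conditional law `κ` of `f` given `π`, then conditionally on `(π, v)` the variables `f` and
`φ π w` are independent with the same law `κ`. -/
lemma map_coupling_apply {π : Ω → Γ} (hπ : Measurable π) {f : Ω → E} (hf : Measurable f)
    {v : Ω₂ → V} (hv : Measurable v) {w : Ω₂ → I} (hw : Measurable w)
    (hvw : IndepFun v w ν) (hwν : ν.map w = volume)
    (κ : Kernel Γ E) [IsMarkovKernel κ] (hκ : P.map (fun ω => (π ω, f ω)) = (P.map π) ⊗ₘ κ)
    {φ : Γ → I → E} (hφ : Measurable (Function.uncurry φ)) (hφκ : ∀ a, volume.map (φ a) = κ a)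
    {T : Set (Γ × V)} (hT : MeasurableSet T) {B C : Set E} (hB : MeasurableSet B)
    (hC : MeasurableSet C) :
    (P.prod ν).map (fun z => ((π z.1, v z.2), f z.1, φ (π z.1) (w z.2))) (T ×ˢ B ×ˢ C)
      = ∫⁻ a, ν.map v (Prod.mk a ⁻¹' T) * κ a B * κ a C ∂P.map π := by
  have hφ' : Measurable fun z : Ω × Ω₂ => φ (π z.1) (w z.2) :=
    hφ.comp (by fun_prop : Measurable fun z : Ω × Ω₂ => (π z.1, w z.2))
  have : IsProbabilityMeasure (ν.map v) := Measure.isProbabilityMeasure_map hv.aemeasurable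
  have : IsProbabilityMeasure (P.map π) := Measure.isProbabilityMeasure_map hπ.aemeasurable
  have hq : Measurable fun a => ν.map v (Prod.mk a ⁻¹' T) := measurable_measure_prodMk_left hT
  have hφC : ∀ a, MeasurableSet (φ a ⁻¹' C) := fun a => hφ.of_uncurry_left hC
  rw [Measure.map_apply (by fun_prop) (hT.prod (hB.prod hC)),
    Measure.prod_apply (((by fun_prop : Measurable fun z : Ω × Ω₂ =>
      ((π z.1, v z.2), f z.1, φ (π z.1) (w z.2)))) (hT.prod (hB.prod hC)))]
  have hsec : ∀ ω, ν (Prod.mk ω ⁻¹' ((fun z : Ω × Ω₂ => ((π z.1, v z.2), f z.1, φ (π z.1) (w z.2)))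
      ⁻¹' T ×ˢ B ×ˢ C))
      = ν.map v (Prod.mk (π ω) ⁻¹' T) * B.indicator 1 (f ω) * κ (π ω) C := by
    intro ω
    by_cases hω : f ω ∈ B
    · have hset : (Prod.mk ω ⁻¹' ((fun z : Ω × Ω₂ =>
          ((π z.1, v z.2), f z.1, φ (π z.1) (w z.2))) ⁻¹' T ×ˢ B ×ˢ C))
          = v ⁻¹' (Prod.mk (π ω) ⁻¹' T) ∩ w ⁻¹' (φ (π ω) ⁻¹' C) := by
        ext u
        simp [hω]
      rw [hset, hvw.measure_inter_preimage_eq_mul _ _ (measurable_prodMk_left hT) (hφC _),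
        Measure.map_apply hv (measurable_prodMk_left hT), ← Measure.map_apply hw (hφC _), hwν,
        ← hφκ, Measure.map_apply hφ.of_uncurry_left hC]
      simp [hω]
    · have hset : (Prod.mk ω ⁻¹' ((fun z : Ω × Ω₂ =>
          ((π z.1, v z.2), f z.1, φ (π z.1) (w z.2))) ⁻¹' T ×ˢ B ×ˢ C)) = ∅ := by
        ext u
        simp [hω]
      rw [hset]
      simp [hω]
  have hκC : Measurable fun a => κ a C := κ.measurable_coe hC
  have hind : Measurable (B.indicator (1 : E → ℝ≥0∞)) := measurable_one.indicator hB
  let F : Γ × E → ℝ≥0∞ := fun z => ν.map v (Prod.mk z.1 ⁻¹' T) * B.indicator 1 z.2 * κ z.1 C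
  have hF : Measurable F :=
    ((hq.comp measurable_fst).mul (hind.comp measurable_snd)).mul (hκC.comp measurable_fst)
  simp_rw [hsec]
  calc ∫⁻ ω, ν.map v (Prod.mk (π ω) ⁻¹' T) * B.indicator 1 (f ω) * κ (π ω) C ∂P
      = ∫⁻ z, F z ∂P.map (fun ω => (π ω, f ω)) := by
        rw [lintegral_map hF (by fun_prop)]
    _ = ∫⁻ a, ∫⁻ x, F (a, x) ∂κ a ∂P.map π := by
        rw [hκ, Measure.lintegral_compProd hF]
    _ = _ := by
        refine lintegral_congr fun a => ?_
        simp only [F]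
        rw [lintegral_mul_const _ (by fun_prop), lintegral_const_mul _ hind,
          lintegral_indicator_one hB]

end Coupling

section Interleave

/-- The sequence `a 0, b 0, a 1, b 1, …`. -/
def interleave {α : Type*} (a b : ℕ → α) (k : ℕ) : α :=
  if k % 2 = 0 then a (k / 2) else b (k / 2)

variable {α : Type*} (a b : ℕ → α) (n : ℕ)

@[simp]
lemma interleave_two_mul : interleave a b (2 * n) = a n := by
  simp [interleave]

@[simp]
lemma interleave_two_mul_add_one : interleave a b (2 * n + 1) = b n := by
  have h1 : (2 * n + 1) % 2 = 1 := by omega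
  have h2 : (2 * n + 1) / 2 = n := by omega
  simp [interleave, h1, h2]

@[simp]
lemma interleave_two_mul_add_two : interleave a b (2 * n + 1 + 1) = a (n + 1) :=
  interleave_two_mul a b (n + 1)

lemma interleave_of_forall {p : ℕ → Prop} (h0 : ∀ n, p (2 * n)) (h1 : ∀ n, p (2 * n + 1)) (k : ℕ) :
    p k := by
  obtain ⟨n, rfl | rfl⟩ := Nat.even_or_odd' k
  exacts [h0 n, h1 n]

lemma sum_range_two_mul {M : Type*} [AddCommMonoid M] (s : ℕ → M) (N : ℕ) :
    ∑ k ∈ Finset.range (2 * N), s k = ∑ n ∈ Finset.range N, (s (2 * n) + s (2 * n + 1)) := by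
  induction N with
  | zero => simp
  | succ N ih =>
    rw [Finset.sum_range_succ, ← ih, Nat.mul_succ, Finset.sum_range_succ, Finset.sum_range_succ,
      add_assoc]

end Interleave

/-- The inequality defining the UMD property in `L_p` with constant `c`. -/
def IsUMD.{u} (X : Type u) [NormedAddCommGroup X] [NormedSpace ℝ X] [CompleteSpace X]
    (p : ℝ≥0∞) (c : ℝ≥0) : Prop :=
  ∀ (Ω : Type u) (mΩ : MeasurableSpace Ω) (P : Measure Ω),
    IsProbabilityMeasure P →
    ∀ (ℱ : Filtration ℕ mΩ) (d : ℕ → Ω → X),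
      (∀ n, StronglyMeasurable[ℱ (n + 1)] (d n)) →
      (∀ n, Integrable (d n) P) →
      (∀ n, P[d n|ℱ n] =ᵐ[P] 0) →
      ∀ ε : ℕ → ℝ, (∀ n, ε n = 1 ∨ ε n = -1) →
      ∀ N : ℕ, eLpNorm (fun ω => ∑ n ∈ Finset.range N, ε n • d n ω) p P
        ≤ c * eLpNorm (fun ω => ∑ n ∈ Finset.range N, d n ω) p P

section UMD

variable {X : Type u} [NormedAddCommGroup X] [NormedSpace ℝ X] [CompleteSpace X]
  [MeasurableSpace X] [BorelSpace X] {p : ℝ≥0∞} {c : ℝ≥0}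

/-- The sums of `f` and `h` are those of the martingale differences
`(f 0 + h 0) / 2, (f 0 - h 0) / 2, (f 1 + h 1) / 2, …` with constant and alternating signs. -/
lemma IsUMD.eLpNorm_sum_le_of_condExchangeable [SecondCountableTopology X] (hX : IsUMD X p c)
    {Ω : Type u} {mΩ : MeasurableSpace Ω} {P : Measure Ω} [IsProbabilityMeasure P]
    {Γ : ℕ → Type*} [∀ n, MeasurableSpace (Γ n)] {Y : ∀ n, Ω → Γ n} {ℱ : Filtration ℕ mΩ}
    (hℱ : ∀ n, ℱ n = MeasurableSpace.comap (Y n) inferInstance) {f h : ℕ → Ω → X}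
    (hf : ∀ n, Measurable[ℱ (n + 1)] (f n)) (hh : ∀ n, Measurable[ℱ (n + 1)] (h n))
    (hfi : ∀ n, Integrable (f n) P) (hf0 : ∀ n, P[f n|ℱ n] =ᵐ[P] 0)
    (H : ∀ n, CondExchangeable P (Y n) (f n) (h n)) (N : ℕ) :
    eLpNorm (fun ω => ∑ n ∈ Finset.range N, h n ω) p P
      ≤ c * eLpNorm (fun ω => ∑ n ∈ Finset.range N, f n ω) p P := by
  have hY : ∀ n, Measurable (Y n) := fun n =>
    comap_le_iff_le_map.1 ((hℱ n).symm.le.trans (ℱ.le n))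
  have hfm : ∀ n, Measurable (f n) := fun n => (hf n).mono (ℱ.le _) le_rfl
  have hhm : ∀ n, Measurable (h n) := fun n => (hh n).mono (ℱ.le _) le_rfl
  have hhi : ∀ n, Integrable (h n) P := fun n => (H n).integrable (hY n) (hfm n) (hhm n) (hfi n)
  have hh0 : ∀ n, P[h n|ℱ n] =ᵐ[P] 0 := fun n => by
    rw [hℱ]
    exact (H n).condExp_ae_eq_zero (hY n) (hfm n) (hhm n) (hfi n) (hℱ n ▸ hf0 n)
  have hadd : ∀ n, Measurable[ℱ (n + 1)] fun ω => f n ω + h n ω := fun n => (hf n).add (hh n)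
  let s : ℕ → MeasurableSpace Ω := fun n =>
    ℱ n ⊔ MeasurableSpace.comap (fun ω => f n ω + h n ω) inferInstance
  have hs : ∀ n, s n ≤ ℱ (n + 1) := fun n =>
    sup_le (ℱ.mono n.le_succ) (Measurable.comap_le (hadd n))
  let 𝒢 : Filtration ℕ mΩ :=
    { seq := interleave ℱ s
      mono' := monotone_nat_of_le_succ <| interleave_of_forall
        (fun n => by
          rw [interleave_two_mul, interleave_two_mul_add_one]
          exact le_sup_left)
        (fun n => by simpa using hs n)
      le' := interleave_of_forall (fun n => by simpa using ℱ.le n)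
        (fun n => by simpa using (hs n).trans (ℱ.le _)) }
  have h𝒢₀ : ∀ n, 𝒢 (2 * n) = ℱ n := interleave_two_mul ℱ s
  have h𝒢₁ : ∀ n, 𝒢 (2 * n + 1) = s n := interleave_two_mul_add_one ℱ s
  have h𝒢₂ : ∀ n, 𝒢 (2 * n + 1 + 1) = ℱ (n + 1) := interleave_two_mul_add_two ℱ s
  let d : ℕ → Ω → X :=
    interleave (fun n => (2⁻¹ : ℝ) • (f n + h n)) (fun n => (2⁻¹ : ℝ) • (f n - h n))
  have hd₀ : ∀ n, d (2 * n) = (2⁻¹ : ℝ) • (f n + h n) := interleave_two_mul _ _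
  have hd₁ : ∀ n, d (2 * n + 1) = (2⁻¹ : ℝ) • (f n - h n) := interleave_two_mul_add_one _ _
  have hdm : ∀ k, StronglyMeasurable[𝒢 (k + 1)] (d k) := by
    refine interleave_of_forall (fun n => ?_) (fun n => ?_)
    · rw [hd₀, h𝒢₁]
      refine StronglyMeasurable.const_smul (Measurable.stronglyMeasurable ?_) _
      exact (comap_measurable (fun ω => f n ω + h n ω)).mono le_sup_right le_rfl
    · rw [hd₁, h𝒢₂]
      exact (((hf n).stronglyMeasurable.sub (hh n).stronglyMeasurable)).const_smul _
  have hdi : ∀ k, Integrable (d k) P := by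
    refine interleave_of_forall (fun n => ?_) (fun n => ?_)
    · rw [hd₀]
      exact ((hfi n).add (hhi n)).smul _
    · rw [hd₁]
      exact ((hfi n).sub (hhi n)).smul _
  have hd0 : ∀ k, P[d k|𝒢 k] =ᵐ[P] 0 := by
    refine interleave_of_forall (fun n => ?_) (fun n => ?_)
    · rw [hd₀, h𝒢₀]
      filter_upwards [condExp_smul (2⁻¹ : ℝ) (f n + h n) (ℱ n) (μ := P),
        condExp_add (hfi n) (hhi n) (ℱ n), hf0 n, hh0 n] with ω h1 h2 h3 h4
      rw [h1, Pi.smul_apply, h2, Pi.add_apply, h3, h4]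
      simp
    · have hsn : s n = MeasurableSpace.comap (fun ω => (Y n ω, f n ω + h n ω)) inferInstance := by
        simp only [s, hℱ]
        exact (MeasurableSpace.comap_prodMk _ _).symm
      rw [hd₁, h𝒢₁, hsn]
      filter_upwards [condExp_smul (2⁻¹ : ℝ) (f n - h n)
          (MeasurableSpace.comap (fun ω => (Y n ω, f n ω + h n ω)) inferInstance) (μ := P),
        (H n).condExp_sub_ae_eq_zero (hY n) (hfm n) (hhm n) (hfi n)] with ω h1 h2
      rw [h1, Pi.smul_apply, h2]
      simp
  let ε : ℕ → ℝ := interleave (fun _ => 1) (fun _ => -1)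
  have hε₀ : ∀ n, ε (2 * n) = 1 := interleave_two_mul _ _
  have hε₁ : ∀ n, ε (2 * n + 1) = -1 := interleave_two_mul_add_one _ _
  have key := hX Ω mΩ P inferInstance 𝒢 d hdm hdi hd0 ε
    (interleave_of_forall (fun n => .inl (hε₀ n)) (fun n => .inr (hε₁ n))) (2 * N)
  have hhalf : ∀ x y : X, (2⁻¹ : ℝ) • (x + y) + (2⁻¹ : ℝ) • (x - y) = x := fun x y => by module
  have hhalf' : ∀ x y : X, (2⁻¹ : ℝ) • (x + y) + -((2⁻¹ : ℝ) • (x - y)) = y :=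
    fun x y => by module
  simpa only [sum_range_two_mul, hd₀, hd₁, hε₀, hε₁, Pi.smul_apply, Pi.add_apply, Pi.sub_apply,
    one_smul, neg_smul, hhalf, hhalf'] using key

omit [MeasurableSpace X] [BorelSpace X] in
/-- The UMD inequality passes to complete subspaces. -/
lemma IsUMD.submodule (hX : IsUMD X p c) (S : Submodule ℝ X) [CompleteSpace S] :
    IsUMD S p c := by
  intro Ω mΩ P hP ℱ d hdm hdi hd0 ε hε N
  have key := hX Ω mΩ P hP ℱ (fun n ω => (d n ω : X))
    (fun n => continuous_subtype_val.comp_stronglyMeasurable (hdm n))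
    (fun n => S.subtypeL.integrable_comp (hdi n))
    (fun n => by
      filter_upwards [S.subtypeL.comp_condExp_comm (hdi n) (m := ℱ n), hd0 n] with ω h1 h2
      rw [Function.comp_apply, h2] at h1
      exact h1.symm) ε hε N
  have hnorm : ∀ s : Ω → S, eLpNorm (fun ω => (s ω : X)) p P = eLpNorm s p P :=
    fun s => eLpNorm_congr_norm_ae (ae_of_all _ fun ω => by simp)
  rw [← hnorm, ← hnorm]
  simpa using key

end UMD

section Tangent

variable {Ω Ω₂ Γ V E : Type*} [MeasurableSpace Ω] [MeasurableSpace Ω₂] [MeasurableSpace Γ]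
  [MeasurableSpace V] [MeasurableSpace E] {P : Measure Ω} [IsProbabilityMeasure P]
  {ν : Measure Ω₂} [IsProbabilityMeasure ν]

lemma condExchangeable_coupling {π : Ω → Γ} (hπ : Measurable π) {f : Ω → E} (hf : Measurable f)
    {v : Ω₂ → V} (hv : Measurable v) {w : Ω₂ → I} (hw : Measurable w)
    (hvw : IndepFun v w ν) (hwν : ν.map w = volume)
    (κ : Kernel Γ E) [IsMarkovKernel κ] (hκ : P.map (fun ω => (π ω, f ω)) = (P.map π) ⊗ₘ κ)
    {φ : Γ → I → E} (hφ : Measurable (Function.uncurry φ)) (hφκ : ∀ a, volume.map (φ a) = κ a) :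
    CondExchangeable (P.prod ν) (fun z => (π z.1, v z.2)) (fun z => f z.1)
      (fun z => φ (π z.1) (w z.2)) := by
  have hφ' : Measurable fun z : Ω × Ω₂ => φ (π z.1) (w z.2) :=
    hφ.comp (by fun_prop : Measurable fun z : Ω × Ω₂ => (π z.1, w z.2))
  refine Measure.ext_prod₃ fun {T B C} hT hB hC => ?_
  have hswap : (P.prod ν).map (fun z => ((π z.1, v z.2), φ (π z.1) (w z.2), f z.1)) (T ×ˢ B ×ˢ C)
      = (P.prod ν).map (fun z => ((π z.1, v z.2), f z.1, φ (π z.1) (w z.2))) (T ×ˢ C ×ˢ B) := by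
    rw [Measure.map_apply (by fun_prop) (hT.prod (hB.prod hC)),
      Measure.map_apply (by fun_prop) (hT.prod (hC.prod hB))]
    congr 1
    ext z
    simp [and_comm]
  rw [hswap, map_coupling_apply hπ hf hv hw hvw hwν κ hκ hφ hφκ hT hB hC,
    map_coupling_apply hπ hf hv hw hvw hwν κ hκ hφ hφκ hT hC hB]
  simp_rw [mul_right_comm]

lemma condExp_comp_fst_ae_eq_zero {X : Type*} [NormedAddCommGroup X] [NormedSpace ℝ X]
    [CompleteSpace X] {π : Ω → Γ} (hπ : Measurable π) {f : Ω → X} (hfi : Integrable f P)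
    (hf0 : P[f|MeasurableSpace.comap π inferInstance] =ᵐ[P] 0) {v : Ω₂ → V} (hv : Measurable v) :
    (P.prod ν)[fun z => f z.1|MeasurableSpace.comap (fun z => (π z.1, v z.2)) inferInstance]
      =ᵐ[P.prod ν] 0 := by
  have hm : Measurable fun z : Ω × Ω₂ => (π z.1, v z.2) := by fun_prop
  have hfi' : Integrable (fun z : Ω × Ω₂ => f z.1) (P.prod ν) := hfi.comp_fst ν
  refine condExp_ae_eq_zero_of_forall_setIntegral_eq_zero hm.comap_le hfi' ?_
  rintro _ ⟨T, hT, rfl⟩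
  rw [← integral_indicator (hm hT), integral_prod_symm _ (hfi'.indicator (hm hT))]
  refine integral_eq_zero_of_ae (ae_of_all _ fun u => ?_)
  have hTu : MeasurableSet ((fun a => (a, v u)) ⁻¹' T) := measurable_prodMk_right hT
  have := setIntegral_eq_zero_of_condExp_ae_eq_zero hπ.comap_le hfi hf0 ⟨_, hTu, rfl⟩
  rw [← integral_indicator (hπ hTu)] at this
  exact this

omit [MeasurableSpace Ω] in
lemma measure_inter_preimage_eq_of_condExp_ind {m m0 : MeasurableSpace Ω} (hm : m ≤ m0)
    {P : Measure Ω} [IsProbabilityMeasure P] {f g : Ω → E} (hf : Measurable f) (hg : Measurable g)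
    {A : Set E} (hA : MeasurableSet A) (h : P[ind A f|m] =ᵐ[P] P[ind A g|m])
    {s : Set Ω} (hs : MeasurableSet[m] s) : P (s ∩ f ⁻¹' A) = P (s ∩ g ⁻¹' A) := by
  have key : ∀ k : Ω → E, Measurable k →
      ∫ ω in s, (P[ind A k|m]) ω ∂P = P.real (s ∩ k ⁻¹' A) := by
    intro k hk
    have hind : ind A k = (k ⁻¹' A).indicator 1 := rfl
    have hint : Integrable (ind A k) P := by
      rw [hind]
      exact (integrable_const (1 : ℝ)).indicator (hk hA)
    rw [setIntegral_condExp hm hint hs, hind, integral_indicator_one (hk hA),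
      measureReal_restrict_apply (hk hA), Set.inter_comm]
  have := setIntegral_congr_ae (μ := P) (s := s) (hm _ hs) (h.mono fun _ h _ => h)
  rw [key f hf, key g hg] at this
  exact (measureReal_eq_measureReal_iff).1 this

end Tangent

section Main

variable {X : Type u} [NormedAddCommGroup X] [NormedSpace ℝ X] [CompleteSpace X]
  [MeasurableSpace X] [BorelSpace X] {p : ℝ≥0∞} {c : ℝ≥0}

lemma IsUMD.eLpNorm_sum_le_of_map_eq [SecondCountableTopology X] (hX : IsUMD X p c)
    {Ω : Type u} {mΩ : MeasurableSpace Ω} {P : Measure Ω} [IsProbabilityMeasure P]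
    {Γ : ℕ → Type*} [∀ n, MeasurableSpace (Γ n)] {π : ∀ n, Ω → Γ n} {ℱ : Filtration ℕ mΩ}
    (hℱ : ∀ n, ℱ n = MeasurableSpace.comap (π n) inferInstance) {f g : ℕ → Ω → X}
    (hf : ∀ n, Measurable[ℱ (n + 1)] (f n)) (hg : ∀ n, Measurable[ℱ (n + 1)] (g n))
    (hfi : ∀ n, Integrable (f n) P) (hf0 : ∀ n, P[f n|ℱ n] =ᵐ[P] 0)
    (H : ∀ n, P.map (fun ω => (π n ω, f n ω)) = P.map (fun ω => (π n ω, g n ω))) (N : ℕ) :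
    eLpNorm (fun ω => ∑ n ∈ Finset.range N, g n ω) p P
      ≤ c * (c * eLpNorm (fun ω => ∑ n ∈ Finset.range N, f n ω) p P) := by
  have hπ : ∀ n, Measurable (π n) := fun n =>
    comap_le_iff_le_map.1 ((hℱ n).symm.le.trans (ℱ.le n))
  have hfm : ∀ n, Measurable (f n) := fun n => (hf n).mono (ℱ.le _) le_rfl
  have hgm : ∀ n, Measurable (g n) := fun n => (hg n).mono (ℱ.le _) le_rfl
  let ν : Measure (ℕ → I) := Measure.infinitePi fun _ => volume
  let κ : ∀ n, Kernel (Γ n) X := fun n => condDistrib (f n) (π n) P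
  have hκf : ∀ n, P.map (fun ω => (π n ω, f n ω)) = (P.map (π n)) ⊗ₘ κ n :=
    fun n => (compProd_map_condDistrib (hfm n).aemeasurable).symm
  choose φ hφ hφκ using fun n => (κ n).exists_measurable_map_eq_unitInterval
  let v : ∀ n : ℕ, (ℕ → I) → (Finset.range n → I) := fun n u i => u i
  have hv : ∀ n, Measurable (v n) := fun n => by fun_prop
  have hw : ∀ n, Measurable fun u : ℕ → I => u n := fun n => by fun_prop
  have hwν : ∀ n, ν.map (fun u => u n) = volume := fun n => Measure.infinitePi_map_eval _ n
  have hind : iIndepFun (fun (n : ℕ) (u : ℕ → I) => u n) ν := by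
    rw [iIndepFun_iff_map_fun_eq_infinitePi_map (by fun_prop), Measure.map_id']
    simp_rw [hwν]
    rfl
  have hvw : ∀ n, IndepFun (v n) (fun u => u n) ν := fun n =>
    (hind.indepFun_finset (Finset.range n) {n} (by simp) hw).comp measurable_id
      (measurable_pi_apply (⟨n, by simp⟩ : ({n} : Finset ℕ)))
  let Y : ∀ n, Ω × (ℕ → I) → Γ n × (Finset.range n → I) := fun n z => (π n z.1, v n z.2)
  have hY : ∀ n, Measurable (Y n) := fun n => by fun_prop
  have hYcomap : ∀ n, MeasurableSpace.comap (Y n) inferInstance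
      = (ℱ n).comap Prod.fst ⊔ MeasurableSpace.comap (fun z => v n z.2) inferInstance := by
    intro n
    rw [hℱ, MeasurableSpace.comap_comp]
    exact MeasurableSpace.comap_prodMk _ _
  let 𝒢 : Filtration ℕ (inferInstance : MeasurableSpace (Ω × (ℕ → I))) :=
    { seq := fun n => MeasurableSpace.comap (Y n) inferInstance
      mono' := by
        intro m n hmn
        simp only [hYcomap]
        refine sup_le_sup (MeasurableSpace.comap_mono (ℱ.mono hmn)) (Measurable.comap_le ?_)
        have h1 : Measurable fun (t : Finset.range n → I) (i : Finset.range m) =>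
            t ⟨i, Finset.range_mono hmn i.2⟩ := by fun_prop
        exact h1.comp (comap_measurable _)
      le' := fun n => (hY n).comap_le }
  have h𝒢 : ∀ n, 𝒢 n = MeasurableSpace.comap (Y n) inferInstance := fun _ => rfl
  have hfst : ∀ n, Measurable[𝒢 n, ℱ n] Prod.fst := fun n => by
    rw [h𝒢, hYcomap]
    exact (comap_measurable _).mono le_sup_left le_rfl
  let h : ℕ → Ω × (ℕ → I) → X := fun n z => φ n (π n z.1) (z.2 n)
  have hf' : ∀ n, Measurable[𝒢 (n + 1)] fun z : Ω × (ℕ → I) => f n z.1 :=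
    fun n => (hf n).comp (hfst _)
  have hg' : ∀ n, Measurable[𝒢 (n + 1)] fun z : Ω × (ℕ → I) => g n z.1 :=
    fun n => (hg n).comp (hfst _)
  have hh' : ∀ n, Measurable[𝒢 (n + 1)] (h n) := by
    intro n
    have h1 : Measurable[𝒢 (n + 1)] fun z : Ω × (ℕ → I) => π n z.1 :=
      ((comap_measurable (Y n)).mono (𝒢.mono n.le_succ) le_rfl).fst
    have h2 : Measurable[𝒢 (n + 1)] fun z : Ω × (ℕ → I) => z.2 n :=
      (measurable_pi_apply (⟨n, by simp⟩ : Finset.range (n + 1))).comp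
        (comap_measurable (Y (n + 1))).snd
    exact (hφ n).comp (h1.prodMk h2)
  have hfi' : ∀ n, Integrable (fun z : Ω × (ℕ → I) => f n z.1) (P.prod ν) :=
    fun n => (hfi n).comp_fst ν
  have hf0' : ∀ n, (P.prod ν)[fun z => f n z.1|𝒢 n] =ᵐ[P.prod ν] 0 :=
    fun n => condExp_comp_fst_ae_eq_zero (hπ n) (hfi n) (hℱ n ▸ hf0 n) (hv n)
  have Hf : ∀ n, CondExchangeable (P.prod ν) (Y n) (fun z => f n z.1) (h n) := fun n =>
    condExchangeable_coupling (hπ n) (hfm n) (hv n) (hw n) (hvw n) (hwν n) (κ n) (hκf n)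
      (hφ n) (hφκ n)
  have Hg : ∀ n, CondExchangeable (P.prod ν) (Y n) (fun z => g n z.1) (h n) := fun n =>
    condExchangeable_coupling (hπ n) (hgm n) (hv n) (hw n) (hvw n) (hwν n) (κ n)
      ((H n).symm.trans (hκf n)) (hφ n) (hφκ n)
  have hhm : ∀ n, Measurable (h n) := fun n => (hh' n).mono (𝒢.le _) le_rfl
  have hfm' : ∀ n, Measurable fun z : Ω × (ℕ → I) => f n z.1 := fun n =>
    (hf' n).mono (𝒢.le _) le_rfl
  have key₁ := hX.eLpNorm_sum_le_of_condExchangeable h𝒢 hf' hh' hfi' hf0' Hf N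
  have key₂ := hX.eLpNorm_sum_le_of_condExchangeable h𝒢 hh' hg'
    (fun n => (Hf n).integrable (hY n) (hfm' n) (hhm n) (hfi' n))
    (fun n => (Hf n).condExp_ae_eq_zero (hY n) (hfm' n) (hhm n) (hfi' n) (hf0' n))
    (fun n => (Hg n).symm) N
  have hnorm : ∀ k : ℕ → Ω → X, (∀ n, Measurable (k n)) →
      eLpNorm (fun z : Ω × (ℕ → I) => ∑ n ∈ Finset.range N, k n z.1) p (P.prod ν)
        = eLpNorm (fun ω => ∑ n ∈ Finset.range N, k n ω) p P := fun k hk =>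
    eLpNorm_comp_measurePreserving (g := fun ω => ∑ n ∈ Finset.range N, k n ω)
      (Finset.measurable_fun_sum _ fun n _ => hk n).aestronglyMeasurable measurePreserving_fst
  rw [hnorm g hgm] at key₂
  rw [hnorm f hfm] at key₁
  exact key₂.trans (mul_le_mul_right key₁ _)

lemma IsUMD.eLpNorm_sum_le_of_tangent (hX : IsUMD X p c)
    {Ω : Type u} {mΩ : MeasurableSpace Ω} {P : Measure Ω} [IsProbabilityMeasure P]
    {ℱ : Filtration ℕ mΩ} {f g : ℕ → Ω → X}
    (hf : ∀ n, StronglyMeasurable[ℱ (n + 1)] (f n)) (hfi : ∀ n, Integrable (f n) P)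
    (hf0 : ∀ n, P[f n|ℱ n] =ᵐ[P] 0) (hg : ∀ n, StronglyMeasurable[ℱ (n + 1)] (g n))
    (H : ∀ n : ℕ, ∀ A : Set X, MeasurableSet A → P[ind A (f n)|ℱ n] =ᵐ[P] P[ind A (g n)|ℱ n])
    (N : ℕ) :
    eLpNorm (fun ω => ∑ n ∈ Finset.range N, g n ω) p P
      ≤ c * (c * eLpNorm (fun ω => ∑ n ∈ Finset.range N, f n ω) p P) := by
  let R : Set X := ⋃ n, (Set.range (f n) ∪ Set.range (g n))
  have hR : TopologicalSpace.IsSeparable R := .iUnion fun n =>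
    (hf n).isSeparable_range.union (hg n).isSeparable_range
  let S : Submodule ℝ X := (Submodule.span ℝ R).topologicalClosure
  have hSclosed : IsClosed (S : Set X) := Submodule.isClosed_topologicalClosure _
  have hS : TopologicalSpace.IsSeparable (S : Set X) := by
    simpa only [S, Submodule.topologicalClosure_coe] using (hR.span (R := ℝ)).closure
  have hRS : R ⊆ S := Submodule.subset_span.trans (Submodule.le_topologicalClosure _)
  have : SecondCountableTopology S := hS.secondCountableTopology
  have : CompleteSpace S := hSclosed.completeSpace_coe
  have hfS : ∀ n ω, f n ω ∈ S := fun n ω => hRS (Set.mem_iUnion.2 ⟨n, .inl ⟨ω, rfl⟩⟩)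
  have hgS : ∀ n ω, g n ω ∈ S := fun n ω => hRS (Set.mem_iUnion.2 ⟨n, .inr ⟨ω, rfl⟩⟩)
  let f' : ℕ → Ω → S := fun n ω => ⟨f n ω, hfS n ω⟩
  let g' : ℕ → Ω → S := fun n ω => ⟨g n ω, hgS n ω⟩
  have hfm : ∀ n, Measurable (f n) := fun n => (hf n).measurable.mono (ℱ.le _) le_rfl
  have hgm : ∀ n, Measurable (g n) := fun n => (hg n).measurable.mono (ℱ.le _) le_rfl
  have hf' : ∀ n, Measurable[ℱ (n + 1)] (f' n) := fun n => (hf n).measurable.subtype_mk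
  have hg' : ∀ n, Measurable[ℱ (n + 1)] (g' n) := fun n => (hg n).measurable.subtype_mk
  have hfm' : ∀ n, Measurable (f' n) := fun n => (hf' n).mono (ℱ.le _) le_rfl
  have hgm' : ∀ n, Measurable (g' n) := fun n => (hg' n).mono (ℱ.le _) le_rfl
  have hfi' : ∀ n, Integrable (f' n) P := fun n =>
    (hfi n).mono (hfm' n).aestronglyMeasurable (ae_of_all _ fun ω => le_rfl)
  have hf0' : ∀ n, P[f' n|ℱ n] =ᵐ[P] 0 := by
    intro n
    filter_upwards [S.subtypeL.comp_condExp_comm (hfi' n) (m := ℱ n), hf0 n] with ω h1 h2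
    have h3 : S.subtypeL ∘ f' n = f n := rfl
    rw [h3, h2] at h1
    exact Subtype.ext h1
  have Hmap : ∀ n, @Measure.map Ω (Ω × S) mΩ (@Prod.instMeasurableSpace Ω S (ℱ n) _)
        (fun ω => (ω, f' n ω)) P
      = @Measure.map Ω (Ω × S) mΩ (@Prod.instMeasurableSpace Ω S (ℱ n) _)
        (fun ω => (ω, g' n ω)) P := by
    intro n
    have hid : Measurable[mΩ, ℱ n] (fun ω => ω : Ω → Ω) := measurable_id'' (ℱ.le n)
    let mn : MeasurableSpace Ω := ℱ n
    have hpf := hid.prodMk (hfm' n)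
    have hpg := hid.prodMk (hgm' n)
    have : IsFiniteMeasure (@Measure.map Ω (Ω × S) mΩ (@Prod.instMeasurableSpace Ω S (ℱ n) _)
        (fun ω => (ω, f' n ω)) P) := by
      infer_instance
    refine Measure.ext_prod fun {s A} hs hA => ?_
    rw [Measure.map_apply hpf (hs.prod hA), Measure.map_apply hpg (hs.prod hA)]
    have hA' : MeasurableSet (Subtype.val '' A : Set X) :=
      (MeasurableEmbedding.subtype_coe hSclosed.measurableSet).measurableSet_image.2 hA
    have := measure_inter_preimage_eq_of_condExp_ind (ℱ.le n) (hfm n) (hgm n) hA' (H n _ hA') hs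
    convert! this using 2 <;> ext ω <;> simp [f', g', hfS, hgS]
  have key := @IsUMD.eLpNorm_sum_le_of_map_eq S _ _ _ _ _ p c _ (hX.submodule S) Ω mΩ P _
    (fun _ => Ω) (fun n => ℱ n) (fun _ ω => ω) ℱ (fun n => MeasurableSpace.comap_id.symm) f' g'
    hf' hg' hfi' hf0' Hmap N
  have hnorm : ∀ s : Ω → S, eLpNorm (fun ω => (s ω : X)) p P = eLpNorm s p P :=
    fun s => eLpNorm_congr_norm_ae (ae_of_all _ fun ω => by simp)
  rw [← hnorm, ← hnorm] at key
  simpa [f', g'] using key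

end Main

end Decoupling

/-- if `X` is UMD in `L_p` with constant `c` (for all Bochner
integrable `X`-valued martingale difference sequences and all signs), then there is a
constant `C` depending only on `c` such that for every filtration with trivial `ℱ_0`
and every pair of tangent `X`-valued Bochner integrable martingale difference
sequences `(f_n)`, `(g_n)`,
`‖Σ_{n<N} g_n‖_{L_p} ≤ C ‖Σ_{n<N} f_n‖_{L_p}` for every `N`. -/
theorem statement9 {X : Type u} [NormedAddCommGroup X] [NormedSpace ℝ X]
    [CompleteSpace X] [MeasurableSpace X] [BorelSpace X]
    (p : ℝ≥0∞) (hp : 1 < p) (hp' : p ≠ ⊤) (c : ℝ≥0) (hc : 0 < c)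
    (hUMD : ∀ (Ω : Type u) (mΩ : MeasurableSpace Ω) (ℙ : Measure Ω),
      IsProbabilityMeasure ℙ →
      ∀ (ℱ : Filtration ℕ mΩ) (d : ℕ → Ω → X),
        (∀ n, StronglyMeasurable[ℱ (n + 1)] (d n)) →
        (∀ n, Integrable (d n) ℙ) →
        (∀ n, ℙ[d n|ℱ n] =ᵐ[ℙ] 0) →
        ∀ ε : ℕ → ℝ, (∀ n, ε n = 1 ∨ ε n = -1) →
        ∀ N : ℕ, eLpNorm (fun ω => ∑ n ∈ Finset.range N, ε n • d n ω) p ℙ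
          ≤ c * eLpNorm (fun ω => ∑ n ∈ Finset.range N, d n ω) p ℙ) :
    ∃ C : ℝ≥0, 0 < C ∧
      ∀ (Ω : Type u) (mΩ : MeasurableSpace Ω) (ℙ : Measure Ω),
      IsProbabilityMeasure ℙ →
      ∀ ℱ : Filtration ℕ mΩ, ℱ 0 = ⊥ →
      ∀ f g : ℕ → Ω → X,
        (∀ n, StronglyMeasurable[ℱ (n + 1)] (f n)) →
        (∀ n, Integrable (f n) ℙ) →
        (∀ n, ℙ[f n|ℱ n] =ᵐ[ℙ] 0) →
        (∀ n, StronglyMeasurable[ℱ (n + 1)] (g n)) →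
        (∀ n, Integrable (g n) ℙ) →
        (∀ n, ℙ[g n|ℱ n] =ᵐ[ℙ] 0) →
        (∀ n : ℕ, ∀ A : Set X, MeasurableSet A →
          ℙ[ind A (f n)|ℱ n] =ᵐ[ℙ] ℙ[ind A (g n)|ℱ n]) →
        ∀ N : ℕ, eLpNorm (fun ω => ∑ n ∈ Finset.range N, g n ω) p ℙ
          ≤ C * eLpNorm (fun ω => ∑ n ∈ Finset.range N, f n ω) p ℙ := by
  have hX : IsUMD X p c := hUMD
  refine ⟨c * c, mul_pos hc hc, ?_⟩
  intro Ω mΩ P hP ℱ _ f g hf hfi hf0 hg _ _ H N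
  rw [ENNReal.coe_mul, mul_assoc]
  exact hX.eLpNorm_sum_le_of_tangent hf hfi hf0 hg H N
end
end

section
/- Let f be a real-valued random variable that is nowhere constant, i.e., ℙ(f = s) = 0 for every s ∈ ℝ, and let g(x) = sup{t ∈ ℝ : ℙ(f < t) < x} for x ∈ (0,1) be its increasing rearrangement. Then g is a strictly increasing function on (0,1), and the minimal complete sigma field on [0,1] (with Lebesgue measure) for which g is measurable is the collection of all Lebesgue measurable subsets of [0,1]. -/
open MeasureTheory MeasurableSpace
open scoped unitInterval

noncomputable section

/-- A nowhere constant real random variable has a distribution function `t ↦ ℙ(f < t)` that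
takes every value in `(0,1)`. -/
lemma exists_measure_lt_eq_ofReal {Ω : Type*} [MeasurableSpace Ω] (P : Measure Ω)
    [IsProbabilityMeasure P] {f : Ω → ℝ} (hf : Measurable f)
    (hnc : ∀ s : ℝ, P {ω | f ω = s} = 0) {x : ℝ} (hx : x ∈ Set.Ioo (0 : ℝ) 1) :
    ∃ t, P {ω | f ω < t} = ENNReal.ofReal x := by
  have : IsProbabilityMeasure (P.map f) := Measure.isProbabilityMeasure_map hf.aemeasurable
  have hatom (s : ℝ) : P.map f {s} = 0 := by
    rw [Measure.map_apply hf (measurableSet_singleton s)]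
    exact hnc s
  have hcont : Continuous (ProbabilityTheory.cdf (P.map f)) := by
    refine continuous_iff_continuousAt.2 fun s => ?_
    rw [(ProbabilityTheory.monotone_cdf _).continuousAt_iff_leftLim_eq_rightLim,
      StieltjesFunction.rightLim_eq]
    have h := hatom s
    rw [← ProbabilityTheory.measure_cdf (P.map f), StieltjesFunction.measure_singleton,
      ENNReal.ofReal_eq_zero] at h
    exact le_antisymm ((ProbabilityTheory.monotone_cdf _).leftLim_le le_rfl) (by linarith)
  obtain ⟨a, ha⟩ :=
    ((ProbabilityTheory.tendsto_cdf_atBot (P.map f)).eventually_lt_const hx.1).exists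
  obtain ⟨b, hb⟩ :=
    ((ProbabilityTheory.tendsto_cdf_atTop (P.map f)).eventually_const_lt hx.2).exists
  obtain ⟨t, ht⟩ := mem_range_of_exists_le_of_exists_ge hcont ⟨a, ha.le⟩ ⟨b, hb.le⟩
  have hno : NullSingletonClass (P.map f) := ⟨hatom⟩
  refine ⟨t, ?_⟩
  rw [← ht, ProbabilityTheory.ofReal_cdf, ← measure_congr (Iio_ae_eq_Iic (μ := P.map f)),
    Measure.map_apply hf measurableSet_Iio]
  rfl

/-- The increasing rearrangement of a nowhere constant random variable is strictly increasing. -/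
lemma strictMonoOn_increasingRearrangement {Ω : Type*} [MeasurableSpace Ω] (P : Measure Ω)
    [IsProbabilityMeasure P] {f : Ω → ℝ} (hf : Measurable f)
    (hnc : ∀ s : ℝ, P {ω | f ω = s} = 0) {g : ℝ → ℝ}
    (hg : ∀ x ∈ Set.Ioo (0 : ℝ) 1,
      g x = sSup {t : ℝ | P {ω | f ω < t} < ENNReal.ofReal x}) :
    StrictMonoOn g (Set.Ioo (0 : ℝ) 1) := by
  have hmono : Monotone fun t : ℝ => P {ω | f ω < t} := fun a b hab =>
    measure_mono fun ω (hω : f ω < a) => hω.trans_le hab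
  have hle {x z c : ℝ} (hxz : x ≤ z) (hc : P {ω | f ω < c} = ENNReal.ofReal z) :
      c ∈ upperBounds {t : ℝ | P {ω | f ω < t} < ENNReal.ofReal x} := fun t ht =>
    (hmono.reflect_lt (ht.trans_le ((ENNReal.ofReal_le_ofReal hxz).trans hc.ge))).le
  have hmem {z y c : ℝ} (hy : 0 < y) (hzy : z < y) (hc : P {ω | f ω < c} = ENNReal.ofReal z) :
      c ∈ {t : ℝ | P {ω | f ω < t} < ENNReal.ofReal y} :=
    hc.trans_lt ((ENNReal.ofReal_lt_ofReal_iff hy).2 hzy)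
  intro x hx y hy hxy
  obtain ⟨z, hxz, hzy⟩ := exists_between hxy
  obtain ⟨w, hw0, hwx⟩ := exists_between hx.1
  obtain ⟨a, ha⟩ := exists_measure_lt_eq_ofReal P hf hnc ⟨hw0, hwx.trans hx.2⟩
  obtain ⟨b, hb⟩ := exists_measure_lt_eq_ofReal P hf hnc hx
  obtain ⟨c, hc⟩ := exists_measure_lt_eq_ofReal P hf hnc ⟨hx.1.trans hxz, hzy.trans hy.2⟩
  obtain ⟨d, hd⟩ := exists_measure_lt_eq_ofReal P hf hnc hy
  rw [hg x hx, hg y hy]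
  calc sSup {t : ℝ | P {ω | f ω < t} < ENNReal.ofReal x}
      ≤ b := csSup_le ⟨a, hmem hx.1 hwx ha⟩ (hle le_rfl hb)
    _ < c := hmono.reflect_lt (by
      simpa only [hb, hc] using (ENNReal.ofReal_lt_ofReal_iff (hx.1.trans hxz)).2 hxz)
    _ ≤ sSup {t : ℝ | P {ω | f ω < t} < ENNReal.ofReal y} :=
      le_csSup ⟨d, hle le_rfl hd⟩ (hmem hy.1 hzy hc)

/-- The sigma field generated by `h` and the null sets consists of null measurable sets. -/
lemma nullMeasurableSet_of_measurableSet_comap_sup {α β : Type*} [MeasurableSpace α]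
    [MeasurableSpace β] {μ : Measure α} {h : α → β} (hh : AEMeasurable h μ) {s : Set α}
    (hs : MeasurableSet[MeasurableSpace.comap h inferInstance
      ⊔ MeasurableSpace.generateFrom {t : Set α | μ t = 0}] s) :
    NullMeasurableSet s μ := by
  refine (sup_le ?_ (generateFrom_le fun t ht => NullMeasurableSet.of_null ht) :
    MeasurableSpace.comap h inferInstance ⊔ MeasurableSpace.generateFrom {t : Set α | μ t = 0}
      ≤ (inferInstance : MeasurableSpace (NullMeasurableSpace α μ))) s hs
  rintro _ ⟨t, ht, rfl⟩
  exact hh.nullMeasurable ht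

/-- A sigma field containing the measurable sets and the null sets contains the null measurable
sets. -/
lemma measurableSet_of_nullMeasurableSet {α : Type*} {m : MeasurableSpace α}
    [m₀ : MeasurableSpace α] {μ : Measure α} (hm : m₀ ≤ m) (hnull : ∀ t, μ t = 0 → MeasurableSet[m] t)
    {s : Set α} (hs : NullMeasurableSet s μ) : MeasurableSet[m] s := by
  obtain ⟨t, ht, hst⟩ := hs
  obtain ⟨h₁, h₂⟩ := ae_eq_set.1 hst
  have key : s = (t \ (t \ s)) ∪ (s \ t) := by
    ext x
    simp only [Set.mem_union, Set.mem_sdiff]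
    tauto
  rw [key]
  exact ((hm t ht).diff (hnull _ h₂)).union (hnull _ h₁)

/-- If `h` is strictly increasing off a null set, then a sigma field containing the null sets for
which `h` is measurable contains the Borel sets. -/
lemma borel_le_of_strictMonoOn {α : Type*} [TopologicalSpace α] [LinearOrder α]
    [OrderTopology α] [SecondCountableTopology α] {m : MeasurableSpace α}
    [m₀ : MeasurableSpace α] [BorelSpace α] {μ : Measure α} {h : α → ℝ} {u : Set α}
    (hu : μ uᶜ = 0) (hh : StrictMonoOn h u)
    (hu' : ∀ a ∉ u, μ (Set.Iio a) = 0 ∨ μ (Set.Ici a) = 0)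
    (hm : MeasurableSpace.comap h inferInstance ≤ m)
    (hnull : ∀ t, μ t = 0 → MeasurableSet[m] t) : m₀ ≤ m := by
  rw [BorelSpace.measurable_eq (α := α), borel_eq_generateFrom_Iio]
  refine generateFrom_le ?_
  rintro _ ⟨a, rfl⟩
  by_cases ha : a ∈ u
  · have hpre : MeasurableSet[m] (h ⁻¹' Set.Iio (h a)) :=
      hm _ ⟨_, measurableSet_Iio, rfl⟩
    have key : Set.Iio a = (h ⁻¹' Set.Iio (h a) \ uᶜ) ∪ (Set.Iio a ∩ uᶜ) := by
      ext x
      by_cases hx : x ∈ u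
      · simp [hx, hh.lt_iff_lt hx ha]
      · simp [hx]
    rw [key]
    exact (hpre.diff (hnull _ hu)).union (hnull _ (measure_mono_null Set.inter_subset_right hu))
  · rcases hu' a ha with h0 | h0
    · exact hnull _ h0
    · rw [← Set.compl_Ici]
      exact (hnull _ h0).compl

/-- if `f` is a nowhere constant real random variable, its increasing
rearrangement `g(x) = sup{t : ℙ(f < t) < x}` is strictly increasing on `(0,1)`, and the
minimal complete sigma field on `[0,1]` (with Lebesgue measure) making `g` measurable
(the sigma field generated by `g` together with all Lebesgue-null sets) is exactly the
collection of Lebesgue measurable (= null measurable) subsets of `[0,1]`. -/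
theorem statement12 {Ω : Type*} [MeasurableSpace Ω] (ℙ : Measure Ω)
    [IsProbabilityMeasure ℙ]
    (f : Ω → ℝ) (hf : Measurable f)
    (hnc : ∀ s : ℝ, ℙ {ω | f ω = s} = 0)
    (g : ℝ → ℝ)
    (hg : ∀ x ∈ Set.Ioo (0 : ℝ) 1,
      g x = sSup {t : ℝ | ℙ {ω | f ω < t} < ENNReal.ofReal x}) :
    StrictMonoOn g (Set.Ioo (0 : ℝ) 1) ∧
    ∀ s : Set I,
      MeasurableSet[MeasurableSpace.comap (fun x : I => g x)
          (inferInstance : MeasurableSpace ℝ)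
        ⊔ MeasurableSpace.generateFrom {t : Set I | volume t = 0}] s
      ↔ NullMeasurableSet s (volume : Measure I) := by
  have hmono := strictMonoOn_increasingRearrangement ℙ hf hnc hg
  set u : Set I := (↑) ⁻¹' Set.Ioo (0 : ℝ) 1
  have hmonoI : StrictMonoOn (fun x : I => g x) u := fun x hx y hy hxy => hmono hx hy hxy
  have hcompl {x : I} (hx : x ∉ u) : x = 0 ∨ x = 1 := by
    by_contra! h
    exact hx ⟨unitInterval.pos_iff_ne_zero.2 h.1, unitInterval.lt_one_iff_ne_one.2 h.2⟩
  have hu : volume uᶜ = 0 :=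
    measure_mono_null (t := {0, 1}) (fun x hx => hcompl hx) ((Set.toFinite _).measure_zero _)
  have hmeas : AEMeasurable (fun x : I => g x) volume := by
    have h := aemeasurable_restrict_of_monotoneOn (μ := volume) (s := u)
      (measurable_subtype_coe measurableSet_Ioo) hmonoI.monotoneOn
    rwa [Measure.restrict_eq_self_of_ae_mem (s := u) (mem_ae_iff.2 hu)] at h
  have hnull (t : Set I) (ht : volume t = 0) :
      MeasurableSet[MeasurableSpace.comap (fun x : I => g x) (inferInstance : MeasurableSpace ℝ)
        ⊔ MeasurableSpace.generateFrom {t : Set I | volume t = 0}] t :=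
    (le_sup_right : MeasurableSpace.generateFrom {t : Set I | volume t = 0} ≤ _) t
      (measurableSet_generateFrom ht)
  refine ⟨hmono, fun s => ⟨nullMeasurableSet_of_measurableSet_comap_sup hmeas,
    measurableSet_of_nullMeasurableSet
      (borel_le_of_strictMonoOn hu hmonoI (fun a ha => ?_) le_sup_left hnull) hnull⟩⟩
  rcases hcompl ha with rfl | rfl
  · left
    exact (congrArg volume Set.Iio_bot).trans measure_empty
  · right
    exact (congrArg volume Set.Ici_top).trans (measure_singleton _)
end
end

section
/- Let (ℱ_n)_{n≥0} be a filtration with ℱ_0 trivial on a probability space, let (S,𝒮) be a measurable space, and let (f_n) and (g_n) be S-valued adapted sequences that are tangent. Then for every n ≥ 1 and every bounded measurable function F : S^{2n−1} → ℝ, E(F(f_1,g_1,…,f_{n−1},g_{n−1},f_n)) = E(F(f_1,g_1,…,f_{n−1},g_{n−1},g_n)). -/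
open MeasureTheory MeasurableSpace

noncomputable section

/-- If `X` and `X'` have the same conditional law given `m` and `Y` is `m`-measurable, then
`(Y, X)` and `(Y, X')` have the same law. -/
theorem map_prodMk_eq_of_condExp_indicator_ae_eq {Ω T S : Type*} {m mΩ : MeasurableSpace Ω}
    [MeasurableSpace T] [MeasurableSpace S] {μ : Measure Ω} [IsFiniteMeasure μ] (hm : m ≤ mΩ)
    {Y : Ω → T} {X X' : Ω → S} (hY : Measurable[m] Y) (hX : Measurable X) (hX' : Measurable X')
    (h : ∀ A : Set S, MeasurableSet A →
      μ[(fun ω => A.indicator (fun _ => (1 : ℝ)) (X ω))|m]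
        =ᵐ[μ] μ[(fun ω => A.indicator (fun _ => (1 : ℝ)) (X' ω))|m]) :
    μ.map (fun ω => (Y ω, X ω)) = μ.map (fun ω => (Y ω, X' ω)) := by
  have hY' : Measurable Y := hY.mono hm le_rfl
  refine Measure.ext_prod fun {B A} hB hA => ?_
  rw [Measure.map_apply (hY'.prodMk hX) (hB.prod hA),
    Measure.map_apply (hY'.prodMk hX') (hB.prod hA), ← measureReal_eq_measureReal_iff]
  have key : ∀ Z : Ω → S, Measurable Z →
      ∫ ω in Y ⁻¹' B, (μ[(fun ω => A.indicator (fun _ => (1 : ℝ)) (Z ω))|m]) ω ∂μ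
        = μ.real ((fun ω => (Y ω, Z ω)) ⁻¹' B ×ˢ A) := by
    intro Z hZ
    have hind : (fun ω => A.indicator (fun _ => (1 : ℝ)) (Z ω))
        = (Z ⁻¹' A).indicator fun _ => 1 := rfl
    rw [hind, setIntegral_condExp hm ((integrable_const _).indicator (hZ hA)) (hY hB),
      setIntegral_indicator (hZ hA), setIntegral_const, smul_eq_mul, mul_one]
    rfl
  rw [← key X hX, ← key X' hX']
  exact integral_congr_ae (ae_restrict_of_ae (h A hA))

/-- if `(f_n)` and `(g_n)` are adapted tangent sequences then for
every `n ≥ 1` and every bounded measurable `F : S^(2n-1) → ℝ`,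
`E F(f_1,g_1,…,f_{n-1},g_{n-1},f_n) = E F(f_1,g_1,…,f_{n-1},g_{n-1},g_n)`.
(0-based indexing: `f k`, `g k` are the `(k+1)`-st terms, adapted to `ℱ (k+1)` and
tangent given `ℱ k`; the statement below, for `n : ℕ`, is the claim for the
`(n+1)`-st level, with vectors of length `2n+1`.) -/
theorem statement14 {Ω : Type*} [mΩ : MeasurableSpace Ω] (ℙ : Measure Ω)
    [IsProbabilityMeasure ℙ]
    {S : Type*} [MeasurableSpace S]
    (ℱ : Filtration ℕ mΩ) (hℱ0 : ℱ 0 = ⊥)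
    (f g : ℕ → Ω → S)
    (hfa : ∀ k, Measurable[ℱ (k + 1)] (f k)) (hga : ∀ k, Measurable[ℱ (k + 1)] (g k))
    (htan : ∀ k : ℕ, ∀ A : Set S, MeasurableSet A →
      ℙ[(fun ω => A.indicator (fun _ => (1 : ℝ)) (f k ω))|ℱ k]
        =ᵐ[ℙ] ℙ[(fun ω => A.indicator (fun _ => (1 : ℝ)) (g k ω))|ℱ k])
    (n : ℕ) (F : (Fin (2 * n + 1) → S) → ℝ)
    (hF : Measurable F) (hFbd : ∃ M : ℝ, ∀ x, |F x| ≤ M) :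
    ∫ ω, F (fun j : Fin (2 * n + 1) =>
        if j.1 % 2 = 0 then f (j.1 / 2) ω else g (j.1 / 2) ω) ∂ℙ
      = ∫ ω, F (fun j : Fin (2 * n + 1) =>
          if j.1 = 2 * n then g n ω
          else if j.1 % 2 = 0 then f (j.1 / 2) ω else g (j.1 / 2) ω) ∂ℙ := by
  have hle : ∀ {k}, k < n → ℱ (k + 1) ≤ ℱ n := fun hk => ℱ.mono hk
  let Y : Ω → Fin (2 * n) → S := fun ω j =>
    if j.1 % 2 = 0 then f (j.1 / 2) ω else g (j.1 / 2) ω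
  have hY : Measurable[ℱ n] Y := by
    refine @measurable_pi_lambda _ _ _ (ℱ n) _ _ fun j => ?_
    have hj : j.1 / 2 < n := by omega
    by_cases h : j.1 % 2 = 0
    · simpa only [Y, h, if_true] using (hfa (j.1 / 2)).mono (hle hj) le_rfl
    · simpa only [Y, h, if_false] using (hga (j.1 / 2)).mono (hle hj) le_rfl
  have hf : Measurable (f n) := (hfa n).mono (ℱ.le _) le_rfl
  have hg : Measurable (g n) := (hga n).mono (ℱ.le _) le_rfl
  have hY' : Measurable Y := hY.mono (ℱ.le n) le_rfl
  let G : (Fin (2 * n) → S) × S → ℝ := fun p =>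
    F fun j => if h : j.1 < 2 * n then p.1 ⟨j.1, h⟩ else p.2
  have hG : Measurable G := by
    refine hF.comp (measurable_pi_lambda _ fun j => ?_)
    by_cases h : j.1 < 2 * n
    · simpa only [h, dif_pos, Function.comp_def] using
        (measurable_pi_apply (⟨j, h⟩ : Fin (2 * n))).comp measurable_fst
    · simpa only [h, dif_neg, not_false_eq_true] using measurable_snd
  have hlaw := map_prodMk_eq_of_condExp_indicator_ae_eq (ℱ.le n) hY hf hg (htan n)
  have hint : ∫ ω, G (Y ω, f n ω) ∂ℙ = ∫ ω, G (Y ω, g n ω) ∂ℙ := by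
    rw [← integral_map (hY'.prodMk hf).aemeasurable hG.aestronglyMeasurable, hlaw,
      integral_map (hY'.prodMk hg).aemeasurable hG.aestronglyMeasurable]
  convert hint using 5 with ω j ω j
  · by_cases h : j.1 < 2 * n
    · simp [Y, h]
    · have hj : j.1 = 2 * n := by omega
      simp [hj]
  · by_cases h : j.1 < 2 * n
    · simp [Y, h, h.ne]
    · have hj : j.1 = 2 * n := by omega
      simp [hj]
end
end

section
/- Let (S,𝒮) be a separable measurable space and let g_n : [0,1]^n → S be measurable functions. On the product probability space [0,1]^ℕ × [0,1]^ℕ (each factor with product Lebesgue measure), define u_n((x_m),(y_m)) = g_n(x_1,…,x_{n−1},x_n) and v_n((x_m),(y_m)) = g_n(x_1,…,x_{n−1},y_n). Then with respect to the filtration (ℒ_n ⊗ ℒ_0)_{n≥0}, the sequence (v_n) is tangent to (u_n), and (v_n) satisfies condition (C.I.) (with conditioning sigma field 𝒢 = ℒ_ℕ ⊗ ℒ_0, generated by the first factor); moreover (u_n) has the same law as (g_n). -/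
open MeasureTheory MeasurableSpace
open scoped unitInterval

noncomputable section

/-- `ℒ_n`: the sigma field on `[0,1]^ℕ` generated by the first `n` coordinates. -/
def Ln (n : ℕ) : MeasurableSpace (ℕ → I) :=
  MeasurableSpace.comap (fun x (i : Fin n) => x i) MeasurableSpace.pi

open ProbabilityTheory

/-- If `X` and `Y` are independent, conditioning `f (X, Y)` on `X` integrates out `Y`. -/
lemma condExp_prodMk_ae_eq_integral_of_indepFun {Ω E F : Type*} [MeasurableSpace Ω]
    [mE : MeasurableSpace E] [MeasurableSpace F] [StandardBorelSpace F] [Nonempty F]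
    {P : Measure Ω} [IsProbabilityMeasure P] {X : Ω → E} {Y : Ω → F}
    (hX : Measurable X) (hY : Measurable Y) (h : IndepFun X Y P)
    {f : E × F → ℝ} (hf : Measurable f) (hfi : Integrable (fun ω => f (X ω, Y ω)) P) :
    P[fun ω => f (X ω, Y ω) | mE.comap X] =ᵐ[P] fun ω => ∫ y, f (X ω, y) ∂(P.map Y) := by
  have hYprob : IsProbabilityMeasure (P.map Y) := Measure.isProbabilityMeasure_map hY.aemeasurable
  have hXprob : IsProbabilityMeasure (P.map X) := Measure.isProbabilityMeasure_map hX.aemeasurable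
  have hdist : condDistrib Y X P =ᵐ[P.map X] Kernel.const E (P.map Y) := by
    refine condDistrib_ae_eq_of_measure_eq_compProd X hY.aemeasurable ?_
    rw [Measure.compProd_const]
    exact (indepFun_iff_map_prod_eq_prod_map_map hX.aemeasurable hY.aemeasurable).1 h
  refine (condExp_prod_ae_eq_integral_condDistrib hX hY.aemeasurable hf.stronglyMeasurable
    hfi).trans ?_
  filter_upwards [ae_of_ae_map hX.aemeasurable hdist] with ω hω
  rw [hω, Kernel.const_apply]

lemma measurable_ind {Ω S : Type*} [MeasurableSpace Ω] [MeasurableSpace S] {A : Set S}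
    (hA : MeasurableSet A) {h : Ω → S} (hh : Measurable h) : Measurable (ind A h) :=
  (measurable_const.indicator hA).comp hh

lemma ind_mem_Icc {Ω S : Type*} (A : Set S) (h : Ω → S) (ω : Ω) : ind A h ω ∈ Set.Icc 0 1 := by
  unfold ind
  by_cases hω : h ω ∈ A <;> simp [hω]

lemma integrable_prod_ind {Ω S ι : Type*} [MeasurableSpace Ω] [MeasurableSpace S] (s : Finset ι)
    {A : ι → Set S} (hA : ∀ i, MeasurableSet (A i)) {h : ι → Ω → S} (hh : ∀ i, Measurable (h i))
    (P : Measure Ω) [IsFiniteMeasure P] :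
    Integrable (fun ω => ∏ i ∈ s, ind (A i) (h i) ω) P := by
  refine Integrable.of_bound
    (Finset.measurable_fun_prod s fun i _ => measurable_ind (hA i) (hh i)).aestronglyMeasurable 1
    (ae_of_all _ fun ω => ?_)
  rw [Real.norm_of_nonneg (Finset.prod_nonneg fun i _ => (ind_mem_Icc _ _ ω).1)]
  exact Finset.prod_le_one (fun i _ => (ind_mem_Icc _ _ ω).1) fun i _ => (ind_mem_Icc _ _ ω).2

lemma integrable_ind {Ω S : Type*} [MeasurableSpace Ω] [MeasurableSpace S]
    {A : Set S} (hA : MeasurableSet A) {h : Ω → S} (hh : Measurable h)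
    (P : Measure Ω) [IsFiniteMeasure P] : Integrable (ind A h) P := by
  simpa using integrable_prod_ind (ι := Unit) {()} (fun _ => hA) (fun _ => hh) P

lemma measurable_fin_snoc_s15 {α : Type*} [MeasurableSpace α] (k : ℕ) :
    Measurable (fun q : (Fin k → α) × α => (Fin.snoc q.1 q.2 : Fin (k + 1) → α)) := by
  refine measurable_pi_lambda _ fun j => ?_
  induction j using Fin.lastCases with
  | last => simpa using measurable_snd
  | cast j => simpa [Function.comp_def] using (measurable_pi_apply j).comp measurable_fst

lemma fin_snoc_init_apply {α : Type*} (x : ℕ → α) (k : ℕ) :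
    (Fin.snoc (fun j : Fin k => x j) (x k) : Fin (k + 1) → α) =
      fun j : Fin (k + 1) => x j := by
  ext j
  induction j using Fin.lastCases with
  | last => simp
  | cast j => simp

/-- The measure of cylinder sets determines the product Lebesgue measure on `[0,1]^ℕ`. -/
lemma eq_infinitePi_of_cylinders {μ : Measure (ℕ → I)}
    (hμ : ∀ (n : ℕ) (A : Fin n → Set I), (∀ i, MeasurableSet (A i)) →
      μ {x : ℕ → I | ∀ i : Fin n, x i ∈ A i} = ∏ i : Fin n, volume (A i)) :
    μ = Measure.infinitePi fun _ => volume := by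
  classical
  refine Measure.eq_infinitePi _ fun s t ht => ?_
  obtain ⟨n, hn⟩ := s.exists_nat_subset_range
  have h := hμ n (fun i => if (i : ℕ) ∈ s then t i else Set.univ) fun i => by
    split_ifs
    exacts [ht _, .univ]
  have hset : {x : ℕ → I | ∀ i : Fin n, x i ∈ if (i : ℕ) ∈ s then t i else Set.univ}
      = Set.pi s t := by
    ext x
    simp only [Set.mem_ofPred_eq, Set.mem_pi, Finset.mem_coe]
    refine ⟨fun hx i hi => ?_, fun hx i => ?_⟩
    · simpa [hi] using hx ⟨i, Finset.mem_range.1 (hn hi)⟩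
    · split_ifs with hi
      exacts [hx i hi, trivial]
  rw [← hset, h, Fin.prod_univ_eq_prod_range
    (fun i => volume (if i ∈ s then t i else Set.univ)) n, ← Finset.prod_subset hn]
  · exact Finset.prod_congr rfl fun i hi => by simp [hi]
  · intro i _ hi
    simp [hi]

/-- Under a product measure the first `n` coordinates have the finite product law. -/
lemma map_infinitePi_init (n : ℕ) :
    (Measure.infinitePi fun _ : ℕ => (volume : Measure I)).map (fun x (i : Fin n) => x i)
      = lamFin n := by
  rw [Measure.map_infinitePi_infinitePi_of_inj (P := fun _ : ℕ => (volume : Measure I))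
    (f := fun i : Fin n => (i : ℕ)) Fin.val_injective, Measure.infinitePi_eq_pi, lamFin]

/-- Under a product measure the first `n` coordinates are independent of the next one. -/
lemma indepFun_init_apply_infinitePi (n : ℕ) :
    IndepFun (fun (x : ℕ → I) (i : Fin n) => x i) (fun x => x n)
      (Measure.infinitePi fun _ : ℕ => (volume : Measure I)) := by
  have h := (iIndepFun_infinitePi (P := fun _ : ℕ => (volume : Measure I))
    (X := fun _ x => x) fun _ => measurable_id).indepFun_finset (Finset.range n) {n}
    (by simp) fun i => measurable_pi_apply i
  have hφ : Measurable fun (y : Finset.range n → I) (i : Fin n) =>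
      y ⟨i, Finset.mem_range.2 i.2⟩ := by fun_prop
  have hψ : Measurable fun y : ({n} : Finset ℕ) → I => y ⟨n, Finset.mem_singleton_self n⟩ :=
    measurable_pi_apply _
  exact h.comp hφ hψ

lemma comap_fst_Ln_sup_comap_snd_Ln_zero (n : ℕ) :
    (Ln n).comap Prod.fst ⊔ (Ln 0).comap Prod.snd
      = MeasurableSpace.comap (fun (p : (ℕ → I) × (ℕ → I)) (i : Fin n) => p.1 i)
        MeasurableSpace.pi := by
  have h0 : Ln 0 = ⊥ := by
    have : (fun (x : ℕ → I) (i : Fin 0) => x i) = fun _ => Fin.elim0 := by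
      ext x i
      exact i.elim0
    rw [Ln, this, MeasurableSpace.comap_const]
  rw [h0, MeasurableSpace.comap_bot, sup_bot_eq, Ln, MeasurableSpace.comap_comp]
  rfl

/-- let `μ` be the product Lebesgue measure on `[0,1]^ℕ`
(characterized by its values on cylinder sets) and let `g_n : [0,1]^n → S` be
measurable.  On `[0,1]^ℕ × [0,1]^ℕ` with the measure `μ ⊗ μ`, set
`u_n((x_m),(y_m)) = g_n(x_1,…,x_n)` and `v_n((x_m),(y_m)) = g_n(x_1,…,x_{n-1},y_n)`.
Then with respect to the filtration `(ℒ_n ⊗ ℒ_0)`, `(v_n)` is tangent to `(u_n)`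
(their conditional laws given `ℒ_{n-1} ⊗ ℒ_0` agree), `(v_n)` satisfies condition
(C.I.) with conditioning sigma field `𝒢 = ℒ_ℕ ⊗ ℒ_0` (the sigma field generated by
the first factor), and `(u_n)` has the same law as `(g_n)`.
(All indexing is 0-based: `u n`, `v n`, `g n` are the `(n+1)`-st terms.) -/
theorem statement15 {S : Type*} [MeasurableSpace S] [CountablyGenerated S]
    (μ : Measure (ℕ → I)) [IsProbabilityMeasure μ]
    (hμ : ∀ (n : ℕ) (A : Fin n → Set I), (∀ i, MeasurableSet (A i)) →
      μ {x : ℕ → I | ∀ i : Fin n, x i ∈ A i} = ∏ i : Fin n, volume (A i))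
    (g : (k : ℕ) → (Fin (k + 1) → I) → S) (hg : ∀ k, Measurable (g k))
    (u v : ℕ → (ℕ → I) × (ℕ → I) → S)
    (hu : ∀ k p, u k p = g k (fun j : Fin (k + 1) => p.1 j))
    (hv : ∀ k p, v k p = g k (Fin.snoc (fun j : Fin k => p.1 j) (p.2 k))) :
    -- `(v_n)` is tangent to `(u_n)` with respect to the filtration `(ℒ_n ⊗ ℒ_0)`
    (∀ n : ℕ, ∀ A : Set S, MeasurableSet A →
      (μ.prod μ)[ind A (u n)|(Ln n).comap Prod.fst ⊔ (Ln 0).comap Prod.snd]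
        =ᵐ[μ.prod μ]
      (μ.prod μ)[ind A (v n)|(Ln n).comap Prod.fst ⊔ (Ln 0).comap Prod.snd]) ∧
    -- `(v_n)` satisfies condition (C.I.) with `𝒢 = ℒ_ℕ ⊗ ℒ_0`:
    -- the conditional law of `v_n` given `ℒ_{n-1} ⊗ ℒ_0` is its conditional law given `𝒢`
    (∀ n : ℕ, ∀ A : Set S, MeasurableSet A →
      (μ.prod μ)[ind A (v n)|(Ln n).comap Prod.fst ⊔ (Ln 0).comap Prod.snd]
        =ᵐ[μ.prod μ]
      (μ.prod μ)[ind A (v n)|MeasurableSpace.comap Prod.fst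
        (inferInstance : MeasurableSpace (ℕ → I))]) ∧
    -- and the `v_n` are conditionally independent given `𝒢`
    (∀ n : ℕ, ∀ A : Fin n → Set S, (∀ i, MeasurableSet (A i)) →
      (μ.prod μ)[(fun p => ∏ i : Fin n, ind (A i) (v i) p)|MeasurableSpace.comap
          Prod.fst (inferInstance : MeasurableSpace (ℕ → I))]
        =ᵐ[μ.prod μ]
      fun p => ∏ i : Fin n,
        ((μ.prod μ)[ind (A i) (v i)|MeasurableSpace.comap Prod.fst
          (inferInstance : MeasurableSpace (ℕ → I))]) p) ∧
    -- `(u_n)` has the same law as `(g_n)`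
    (∀ n : ℕ, Measure.map (fun p (k : Fin n) => u k p) (μ.prod μ)
        = Measure.map (seqLift g n) (lamFin n)) := by
  have hpi := eq_infinitePi_of_cylinders hμ
  have hinit (n : ℕ) : Measurable (fun (x : ℕ → I) (i : Fin n) => x i) := by fun_prop
  have hev (n : ℕ) : Measurable (fun x : ℕ → I => x n) := measurable_pi_apply n
  have hmap_eval (n : ℕ) : μ.map (fun x => x n) = volume := by
    rw [hpi, Measure.infinitePi_map_eval]
  have hmap_init (n : ℕ) : μ.map (fun x (i : Fin n) => x i) = lamFin n := by
    rw [hpi, map_infinitePi_init]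
  have hfst {E : Type} [MeasurableSpace E] {X : (ℕ → I) → E} (hX : Measurable X) :
      (μ.prod μ).map (fun p => X p.1) = μ.map X := by
    rw [← Function.comp_def X, ← Measure.map_map hX measurable_fst, Measure.map_fst_prod,
      measure_univ, one_smul]
  have hsnd {E : Type} [MeasurableSpace E] {X : (ℕ → I) → E} (hX : Measurable X) :
      (μ.prod μ).map (fun p => X p.2) = μ.map X := by
    rw [← Function.comp_def X, ← Measure.map_map hX measurable_snd, Measure.map_snd_prod,
      measure_univ, one_smul]
  have hu_eq (k : ℕ) : u k = fun p => g k (Fin.snoc (fun j : Fin k => p.1 j) (p.1 k)) := by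
    ext p
    rw [hu, fin_snoc_init_apply]
  have hv_eq (k : ℕ) : v k = fun p => g k (Fin.snoc (fun j : Fin k => p.1 j) (p.2 k)) :=
    funext (hv k)
  have hgs (k : ℕ) : Measurable fun q : (Fin k → I) × I => g k (Fin.snoc q.1 q.2) :=
    (hg k).comp (measurable_fin_snoc_s15 k)
  have hum (k : ℕ) : Measurable (u k) := by
    rw [hu_eq]
    exact (hgs k).comp (((hinit k).comp measurable_fst).prodMk ((hev k).comp measurable_fst))
  have hvm (k : ℕ) : Measurable (v k) := by
    rw [hv_eq]
    exact (hgs k).comp (((hinit k).comp measurable_fst).prodMk ((hev k).comp measurable_snd))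
  -- all conditional laws are obtained by integrating out the last variable of `g n`
  let G (n : ℕ) (A : Set S) (p : (ℕ → I) × (ℕ → I)) : ℝ :=
    ∫ t : I, ind A (fun t => g n (Fin.snoc (fun j : Fin n => p.1 j) t)) t
  have hU (n : ℕ) (A : Set S) (hA : MeasurableSet A) :
      (μ.prod μ)[ind A (u n)|(Ln n).comap Prod.fst ⊔ (Ln 0).comap Prod.snd]
        =ᵐ[μ.prod μ] G n A := by
    rw [comap_fst_Ln_sup_comap_snd_Ln_zero]
    have hX : Measurable fun (p : (ℕ → I) × (ℕ → I)) (i : Fin n) => p.1 i :=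
      (hinit n).comp measurable_fst
    have hY : Measurable fun p : (ℕ → I) × (ℕ → I) => p.1 n := (hev n).comp measurable_fst
    have hind : IndepFun (fun (p : (ℕ → I) × (ℕ → I)) (i : Fin n) => p.1 i)
        (fun p => p.1 n) (μ.prod μ) := by
      have h := indepFun_init_apply_infinitePi n
      rw [← hpi, indepFun_iff_map_prod_eq_prod_map_map (hinit n).aemeasurable
        (hev n).aemeasurable] at h
      rw [indepFun_iff_map_prod_eq_prod_map_map hX.aemeasurable hY.aemeasurable,
        hfst (hinit n), hfst (hev n), ← h]
      exact hfst ((hinit n).prodMk (hev n))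
    have hi := integrable_ind hA (hum n) (μ.prod μ)
    have h := condExp_prodMk_ae_eq_integral_of_indepFun hX hY hind
      (f := ind A fun q => g n (Fin.snoc q.1 q.2)) (measurable_ind hA (hgs n))
      (by rw [hu_eq] at hi; exact hi)
    rw [hfst (hev n), hmap_eval] at h
    rw [hu_eq]
    exact h
  have hV (n : ℕ) (A : Set S) (hA : MeasurableSet A) :
      (μ.prod μ)[ind A (v n)|(Ln n).comap Prod.fst ⊔ (Ln 0).comap Prod.snd]
        =ᵐ[μ.prod μ] G n A := by
    rw [comap_fst_Ln_sup_comap_snd_Ln_zero]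
    have hi := integrable_ind hA (hvm n) (μ.prod μ)
    have h := condExp_prodMk_ae_eq_integral_of_indepFun ((hinit n).comp measurable_fst)
      ((hev n).comp measurable_snd) (indepFun_prod (hinit n) (hev n))
      (f := ind A fun q => g n (Fin.snoc q.1 q.2)) (measurable_ind hA (hgs n))
      (by rw [hv_eq] at hi; exact hi)
    rw [Function.comp_def (fun x : ℕ → I => x n), hsnd (hev n), hmap_eval] at h
    rw [hv_eq]
    exact h
  have hW (n : ℕ) (A : Fin n → Set S) (hA : ∀ i, MeasurableSet (A i)) :
      (μ.prod μ)[(fun p => ∏ i : Fin n, ind (A i) (v i) p)|MeasurableSpace.comap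
          Prod.fst (inferInstance : MeasurableSpace (ℕ → I))]
        =ᵐ[μ.prod μ] fun p => ∏ i : Fin n, G i (A i) p := by
    have hi := integrable_prod_ind Finset.univ hA (fun i : Fin n => hvm i) (μ.prod μ)
    have hf : Measurable fun q : (ℕ → I) × (Fin n → I) => ∏ i : Fin n,
        ind (A i) (fun q => g i (Fin.snoc (fun j : Fin i => q.1 j) (q.2 i))) q :=
      Finset.measurable_fun_prod _ fun i _ => measurable_ind (hA i) <| (hgs i).comp <|
        ((hinit i).comp measurable_fst).prodMk ((measurable_pi_apply i).comp measurable_snd)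
    have h := condExp_prodMk_ae_eq_integral_of_indepFun measurable_fst
      ((hinit n).comp measurable_snd) (indepFun_prod measurable_id (hinit n)) hf
      (by simp_rw [hv_eq] at hi; exact hi)
    rw [Function.comp_def (fun (x : ℕ → I) (i : Fin n) => x i), hsnd (hinit n),
      hmap_init] at h
    simp_rw [hv_eq]
    refine h.trans (ae_of_all _ fun p => ?_)
    exact integral_fintype_prod_eq_prod (𝕜 := ℝ) (μ := fun _ : Fin n => (volume : Measure I))
      fun i t => ind (A i) (fun t => g i (Fin.snoc (fun j : Fin i => p.1 j) t)) t
  have hV' (n : ℕ) (A : Set S) (hA : MeasurableSet A) :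
      (μ.prod μ)[ind A (v n)|MeasurableSpace.comap Prod.fst
        (inferInstance : MeasurableSpace (ℕ → I))] =ᵐ[μ.prod μ] G n A := by
    have hi := integrable_ind hA (hvm n) (μ.prod μ)
    have hf : Measurable (ind A fun q : (ℕ → I) × I =>
        g n (Fin.snoc (fun j : Fin n => q.1 j) q.2)) :=
      measurable_ind hA <| (hgs n).comp <| ((hinit n).comp measurable_fst).prodMk measurable_snd
    have h := condExp_prodMk_ae_eq_integral_of_indepFun measurable_fst
      ((hev n).comp measurable_snd) (indepFun_prod measurable_id (hev n)) hf
      (by rw [hv_eq] at hi; exact hi)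
    rw [Function.comp_def (fun x : ℕ → I => x n), hsnd (hev n), hmap_eval] at h
    rw [hv_eq]
    exact h
  refine ⟨fun n A hA => (hU n A hA).trans (hV n A hA).symm,
    fun n A hA => (hV n A hA).trans (hV' n A hA).symm, fun n A hA => ?_, fun n => ?_⟩
  · filter_upwards [hW n A hA, ae_all_iff.2 fun i : Fin n => hV' i (A i) (hA i)] with p hp hp'
    rw [hp]
    exact Finset.prod_congr rfl fun i _ => (hp' i).symm
  · have hlift : Measurable (seqLift g n) :=
      measurable_pi_lambda _ fun k => (hg k).comp (by fun_prop)
    rw [← hmap_init, ← hfst (hinit n), ← Function.comp_def (fun (x : ℕ → I) (i : Fin n) => x i),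
      Measure.map_map hlift ((hinit n).comp measurable_fst)]
    congr 1
    ext p k
    exact hu k p
end
end
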